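/- Theorem A, second part (embedding of the ω-limit set into ℝ^k): Let Φ be a semiflow on X strongly focusing monotone with respect to the k-cone C, satisfying the standing assumptions, and let O⁺(x) be a precompact pseudo-ordered semiorbit. Choose a k-dimensional subspace H ⊆ C and a closed k-codimensional subspace H^c with H^c∖{0} ⊆ X∖C and X = H ⊕ H^c, and let Θ be the projection onto H along H^c. Then Θ restricted to ω(x) is injective, hence a homeomorphism of ω(x) onto the compact set Θ(ω(x)) ⊆ H, and there is a continuous flow ψ on Θ(ω(x)) with Θ(Φ_t(z)) = ψ_t(Θ(z)) for all z ∈ ω(x) and t ≥ 0; in particular ω(x) is topologically conjugate to a compact invariant set of a flow on a k-dimensional space. -/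

import Mathlib

open Set Metric Filter

/-- A semiflow on `X`: continuous on `[0,∞) × X`, `Φ₀ = id`, `Φ_{s+t} = Φ_s ∘ Φ_t`. -/
structure Semiflow (X : Type*) [NormedAddCommGroup X] [NormedSpace ℝ X] where
  toFun : ℝ → X → X
  cont : ContinuousOn (fun p : ℝ × X => toFun p.1 p.2) (Set.Ici (0:ℝ) ×ˢ Set.univ)
  map_zero : ∀ x, toFun 0 x = x
  map_add : ∀ s t : ℝ, 0 ≤ s → 0 ≤ t → ∀ x, toFun (s + t) x = toFun s (toFun t x)

section Defs

variable {X : Type*} [NormedAddCommGroup X] [NormedSpace ℝ X]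

/-- A cone of rank `k`: a closed set, stable under all real scalings, containing a
`k`-dimensional subspace and no subspace of higher dimension. -/
def IsKCone (C : Set X) (k : ℕ) : Prop :=
  IsClosed C ∧ (∀ (t : ℝ) (v : X), v ∈ C → t • v ∈ C) ∧
  (∃ W : Submodule ℝ X, (W : Set X) ⊆ C ∧ Module.rank ℝ W = k) ∧
  (∀ W : Submodule ℝ X, (W : Set X) ⊆ C → Module.rank ℝ W ≤ k)

/-- `C` is `k`-solid: some `k`-dimensional subspace `W` has `W \ {0} ⊆ int C`. -/
def IsKSolid (C : Set X) (k : ℕ) : Prop :=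
  ∃ W : Submodule ℝ X, Module.rank ℝ W = k ∧ ((W : Set X) \ {0}) ⊆ interior C

/-- `C` is complemented: some closed subspace of codimension `k` meets `C` only at `0`. -/
def IsComplementedCone (C : Set X) (k : ℕ) : Prop :=
  ∃ H : Submodule ℝ X, IsClosed (H : Set X) ∧ Module.rank ℝ (X ⧸ H) = k ∧
    (H : Set X) ∩ C = {0}

/-- The positive semiorbit `O⁺(x)`. -/
def posOrbit (Φ : Semiflow X) (x : X) : Set X := {y | ∃ t, 0 ≤ t ∧ y = Φ.toFun t x}

/-- The ω-limit set `ω(x) = ⋂_{s ≥ 0} cl {Φ_t(x) : t ≥ s}`. -/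
def omegaSet (Φ : Semiflow X) (x : X) : Set X :=
  ⋂ s ∈ Set.Ici (0:ℝ), closure {y | ∃ t, s ≤ t ∧ y = Φ.toFun t x}

/-- The set of equilibria of `Φ`. -/
def equilibria (Φ : Semiflow X) : Set X := {p | ∀ t, 0 ≤ t → Φ.toFun t p = p}

/-- `S` is invariant: `Φ_t(S) = S` for all `t ≥ 0`. -/
def Invariant (Φ : Semiflow X) (S : Set X) : Prop := ∀ t, 0 ≤ t → Φ.toFun t '' S = S

/-- A set is ordered w.r.t. `C` if any two of its points are ordered. -/
def OrderedSet (C S : Set X) : Prop := ∀ x ∈ S, ∀ y ∈ S, x - y ∈ C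

/-- A set is unordered w.r.t. `C` if it is not a singleton and any two distinct points are
unordered. -/
def UnorderedSet (C S : Set X) : Prop :=
  (¬ ∃ a, S = {a}) ∧ ∀ x ∈ S, ∀ y ∈ S, x ≠ y → x - y ∉ C

/-- Two sets `A ∼ B`: every point of `A` is ordered with every point of `B`. -/
def SetsOrdered (C A B : Set X) : Prop := ∀ a ∈ A, ∀ b ∈ B, a - b ∈ C

/-- `Φ` is strongly monotone with respect to the cone `C`. -/
def StronglyMonotone (Φ : Semiflow X) (C : Set X) : Prop :=
  (∀ t, 0 ≤ t → ∀ x y : X, x - y ∈ C → Φ.toFun t x - Φ.toFun t y ∈ C) ∧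
  (∀ t, 0 < t → ∀ x y : X, x - y ∈ C → x ≠ y → Φ.toFun t x - Φ.toFun t y ∈ interior C)

/-- `O⁺(x)` is pseudo-ordered. -/
def PseudoOrdered (Φ : Semiflow X) (C : Set X) (x : X) : Prop :=
  ∃ t₁ t₂ : ℝ, 0 ≤ t₁ ∧ 0 ≤ t₂ ∧ Φ.toFun t₁ x ≠ Φ.toFun t₂ x ∧
    Φ.toFun t₁ x - Φ.toFun t₂ x ∈ C

/-- A bounded operator `R` is strongly focusing w.r.t. `C` with separation index `κ`:
`0 ∉ R(C \ {0})` and every unit vector of `RC` is at distance at least `κ` from `X \ C`. -/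
def StronglyFocusing (R : X →L[ℝ] X) (C : Set X) (κ : ℝ) : Prop :=
  (∀ v ∈ C, v ≠ 0 → R v ≠ 0) ∧
  (∀ v ∈ R '' C, ‖v‖ = 1 → ∀ u ∉ C, κ ≤ ‖v - u‖)

/-- `Φ` is strongly focusing monotone with respect to `C`, with `x`-derivative `DΦ`. -/
def StronglyFocusingMonotone (Φ : Semiflow X) (DΦ : ℝ → X → X →L[ℝ] X) (C : Set X) : Prop :=
  (∀ t, 0 ≤ t → ∀ x : X, HasFDerivAt (Φ.toFun t) (DΦ t x) x) ∧
  (∀ t, 0 ≤ t → Continuous fun x : X => DΦ t x) ∧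
  StronglyMonotone Φ C ∧
  (∀ t, 0 < t → ∀ x : X, ∀ v ∈ C, v ≠ 0 → DΦ t x v ∈ interior C) ∧
  (∀ S : Set X, IsCompact S → Invariant Φ S →
    ∃ δ > (0:ℝ), ∃ T > (0:ℝ), ∃ κ > (0:ℝ), ∀ z ∈ S, ∀ x ∈ Metric.closedBall z δ,
      ∀ y ∈ Metric.closedBall z δ, ∃ R : X →L[ℝ] X,
        StronglyFocusing R C κ ∧ R (x - y) = Φ.toFun T x - Φ.toFun T y)

/-- `ψ` is a flow extension of `Φ` on the invariant set `S`. -/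
def IsFlowExtensionOn (Φ : Semiflow X) (ψ : ℝ → X → X) (S : Set X) : Prop :=
  (∀ t, 0 ≤ t → ∀ z ∈ S, ψ t z = Φ.toFun t z) ∧
  (∀ t : ℝ, ∀ z ∈ S, ψ t z ∈ S) ∧
  (∀ s t : ℝ, ∀ z ∈ S, ψ s (ψ t z) = ψ (s + t) z) ∧
  ContinuousOn (fun p : ℝ × X => ψ p.1 p.2) (Set.univ ×ˢ S)

/-- `Φ` admits a flow extension on each ω-limit set. -/
def AdmitsFlowExtensions (Φ : Semiflow X) : Prop :=
  ∀ x : X, ∃ ψ : ℝ → X → X, IsFlowExtensionOn Φ ψ (omegaSet Φ x)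

/-- The α-limit set of `z` along the (extended) flow `ψ`. -/
def alphaSet (ψ : ℝ → X → X) (z : X) : Set X :=
  ⋂ s ∈ Set.Ici (0:ℝ), closure {y | ∃ t, s ≤ t ∧ y = ψ (-t) z}

/-- Standing assumptions: `C` is a complemented `k`-solid `k`-cone, the derivative
`D_xΦ_t` is a compact operator for all `x` and `t > 0`, and `Φ` admits a flow extension on
each ω-limit set. -/
def StandingAssumptions (Φ : Semiflow X) (DΦ : ℝ → X → X →L[ℝ] X)
    (C : Set X) (k : ℕ) : Prop :=
  IsKCone C k ∧ IsKSolid C k ∧ IsComplementedCone C k ∧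
  (∀ t, 0 < t → ∀ x : X, IsCompactOperator ⇑(DΦ t x)) ∧
  AdmitsFlowExtensions Φ

end Defs

section Cone

variable {X : Type*} [NormedAddCommGroup X] [NormedSpace ℝ X] {C : Set X}

/-- The vectors `v` whose distance to the complement of `C` is at least `κ * ‖v‖`. -/
def coneCore (C : Set X) (κ : ℝ) : Set X := {v | ∀ u ∉ C, κ * ‖v‖ ≤ ‖v - u‖}

lemma neg_mem_cone (hsm : ∀ (t : ℝ) (v : X), v ∈ C → t • v ∈ C) {v : X} (hv : v ∈ C) :
    -v ∈ C := by
  simpa using hsm (-1) v hv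

lemma sub_mem_cone_comm (hsm : ∀ (t : ℝ) (v : X), v ∈ C → t • v ∈ C) {v w : X} :
    v - w ∈ C ↔ w - v ∈ C :=
  ⟨fun h => by simpa using neg_mem_cone hsm h, fun h => by simpa using neg_mem_cone hsm h⟩

lemma smul_mem_cone_iff (hsm : ∀ (t : ℝ) (v : X), v ∈ C → t • v ∈ C) {t : ℝ} (ht : t ≠ 0)
    {v : X} : t • v ∈ C ↔ v ∈ C :=
  ⟨fun h => by simpa [smul_smul, inv_mul_cancel₀ ht] using hsm t⁻¹ _ h, hsm t v⟩

lemma sub_mem_interior_cone_comm (hsm : ∀ (t : ℝ) (v : X), v ∈ C → t • v ∈ C) {v w : X} :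
    v - w ∈ interior C ↔ w - v ∈ interior C := by
  have hneg : ∀ {y : X}, y ∈ interior C → -y ∈ interior C := by
    intro y hy
    rw [mem_interior_iff_mem_nhds] at hy ⊢
    have hc : Tendsto (fun z : X => -z) (nhds (-y)) (nhds y) := by
      simpa using (continuous_neg.tendsto (-y) : Tendsto (fun z : X => -z) _ _)
    filter_upwards [hc hy] with z hz
    simpa using neg_mem_cone hsm hz
  exact ⟨fun h => by simpa using hneg h, fun h => by simpa using hneg h⟩

/-- A homogeneous set with `0` in its interior is everything. -/
lemma zero_notMem_interior_cone (hsm : ∀ (t : ℝ) (v : X), v ∈ C → t • v ∈ C) {w : X}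
    (hw : w ∉ C) : (0 : X) ∉ interior C := by
  intro h0
  rw [mem_interior_iff_mem_nhds] at h0
  have hc : Tendsto (fun t : ℝ => t • w) (nhdsWithin 0 {0}ᶜ) (nhds 0) := by
    have : Tendsto (fun t : ℝ => t • w) (nhds 0) (nhds ((0 : ℝ) • w)) :=
      (continuous_id.smul continuous_const).tendsto 0
    rw [zero_smul] at this
    exact this.mono_left nhdsWithin_le_nhds
  have h1 : ∀ᶠ t in nhdsWithin (0 : ℝ) {0}ᶜ, t • w ∈ C := hc h0
  obtain ⟨t, ht, ht0⟩ := (h1.and self_mem_nhdsWithin).exists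
  exact hw ((smul_mem_cone_iff hsm ht0).1 ht)

lemma smul_mem_coneCore (hsm : ∀ (t : ℝ) (v : X), v ∈ C → t • v ∈ C) {κ : ℝ} {v : X}
    (hv : v ∈ coneCore C κ) (t : ℝ) : t • v ∈ coneCore C κ := by
  intro u hu
  rcases eq_or_ne t 0 with rfl | ht
  · simp
  · have h := hv (t⁻¹ • u) (fun h => hu ((smul_mem_cone_iff hsm (inv_ne_zero ht)).1 h))
    have e : t • v - u = t • (v - t⁻¹ • u) := by
      rw [smul_sub, smul_smul, mul_inv_cancel₀ ht, one_smul]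
    rw [e, norm_smul, norm_smul]
    nlinarith [norm_nonneg t]

lemma isClosed_coneCore (κ : ℝ) : IsClosed (coneCore C κ) := by
  have : coneCore C κ = ⋂ u ∈ Cᶜ, {v : X | κ * ‖v‖ ≤ ‖v - u‖} := by
    ext v; simp [coneCore]
  rw [this]
  exact isClosed_biInter fun u _ => isClosed_le (by fun_prop) (by fun_prop)

lemma add_mem_of_mem_coneCore {κ : ℝ} {v e : X} (hv : v ∈ coneCore C κ)
    (he : ‖e‖ < κ * ‖v‖) : v + e ∈ C := by
  by_contra h
  have := hv _ h
  simp at this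
  linarith

lemma mem_coneCore_of_norm_sub_le {κ κ' β : ℝ} {v v' : X} (hv : v ∈ coneCore C κ)
    (hβ : ‖v' - v‖ ≤ β * ‖v‖) (hκ' : 0 ≤ κ') (h : κ' * (1 + β) ≤ κ - β) :
    v' ∈ coneCore C κ' := by
  intro u hu
  have h1 := hv u hu
  have h2 : ‖v - u‖ ≤ ‖v' - u‖ + ‖v' - v‖ := by
    have : v - u = (v' - u) - (v' - v) := by abel
    rw [this]; exact norm_sub_le _ _
  have h3 : ‖v'‖ ≤ ‖v' - v‖ + ‖v‖ := by
    simpa using norm_add_le (v' - v) v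
  have h4 : κ' * ‖v'‖ ≤ κ' * ((1 + β) * ‖v‖) := by
    apply mul_le_mul_of_nonneg_left _ hκ'; linarith
  have h5 : κ' * (1 + β) * ‖v‖ ≤ (κ - β) * ‖v‖ := mul_le_mul_of_nonneg_right h (norm_nonneg v)
  nlinarith

lemma mem_cone_of_mem_coneCore (h0 : (0 : X) ∈ C) {κ : ℝ} (hκ : 0 < κ) {v : X}
    (hv : v ∈ coneCore C κ) : v ∈ C := by
  rcases eq_or_ne v 0 with rfl | hv0
  · exact h0
  · have := add_mem_of_mem_coneCore (e := 0) hv (by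
      rw [norm_zero]; exact mul_pos hκ (norm_pos_iff.2 hv0))
    simpa using this

lemma map_mem_coneCore_of_stronglyFocusing (hsm : ∀ (t : ℝ) (v : X), v ∈ C → t • v ∈ C)
    {R : X →L[ℝ] X} {κ κ' : ℝ} (hR : StronglyFocusing R C κ) (hκ : κ' ≤ κ) {v : X}
    (hv : v ∈ C) : R v ∈ coneCore C κ' := by
  rcases eq_or_ne (R v) 0 with h0 | h0
  · intro u _; simp [h0]
  · have hn : ‖R v‖ ≠ 0 := norm_ne_zero_iff.2 h0
    have h1 : (‖R v‖⁻¹ • R v) ∈ coneCore C κ' := by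
      intro u hu
      have hnorm : ‖‖R v‖⁻¹ • R v‖ = 1 := by
        rw [norm_smul, norm_inv, norm_norm, inv_mul_cancel₀ hn]
      rw [hnorm, mul_one]
      exact hκ.trans (hR.2 _ ⟨‖R v‖⁻¹ • v, hsm _ _ hv, by simp⟩ hnorm u hu)
    have h2 := smul_mem_coneCore hsm h1 ‖R v‖
    rwa [smul_smul, mul_inv_cancel₀ hn, one_smul] at h2

/-- Along a segment of the line `v + ℝ u` inside the core of the cone, with `u` outside the
cone, norms are comparable. -/
lemma norm_le_of_line_mem_coneCore (hsm : ∀ (t : ℝ) (v : X), v ∈ C → t • v ∈ C) {κ σ : ℝ}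
    (hκ : 0 < κ) (hκ1 : κ ≤ 1) (hσ : 0 ≤ σ) {u v : X} (hu : u ∉ C)
    (h : ∀ s : ℝ, |s| ≤ σ → v + s • u ∈ coneCore C κ) {s : ℝ} (hs : |s| ≤ σ) :
    κ * ‖v‖ ≤ ‖v + s • u‖ ∧ κ * (σ * ‖u‖) ≤ ‖v + s • u‖ := by
  have key : ∀ s' : ℝ, |s'| ≤ σ → κ * ‖v + s' • u‖ ≤ ‖v + s • u‖ := by
    intro s' hs'
    rcases eq_or_ne s' s with rfl | hne
    · nlinarith [norm_nonneg (v + s' • u)]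
    · have := h s' hs' ((s' - s) • u)
        (fun hc => hu ((smul_mem_cone_iff hsm (sub_ne_zero.2 hne)).1 hc))
      have e : v + s' • u - (s' - s) • u = v + s • u := by rw [sub_smul]; abel
      rwa [e] at this
  refine ⟨by simpa using key 0 (by simpa using hσ), ?_⟩
  have h1 := key σ (abs_of_nonneg hσ).le
  have h2 := key (-σ) (by rw [abs_neg]; exact (abs_of_nonneg hσ).le)
  have h3 : 2 * (σ * ‖u‖) ≤ ‖v + σ • u‖ + ‖v + (-σ) • u‖ := by
    have e : (2 * σ) • u = (v + σ • u) - (v + (-σ) • u) := by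
      rw [neg_smul, two_mul, add_smul]; abel
    have : ‖(2 * σ) • u‖ = 2 * (σ * ‖u‖) := by
      rw [norm_smul, Real.norm_of_nonneg (by linarith)]; ring
    rw [← this, e]; exact norm_sub_le _ _
  nlinarith

/-- A focusing operator is bounded below on the core of the cone. -/
lemma exists_le_norm_map_of_mem_coneCore [CompleteSpace X] {k : ℕ} (hC : IsKCone C k)
    {κ κ' : ℝ} (hκ : 0 < κ) (hκ' : 0 < κ') {L : X →L[ℝ] X}
    (hL : ∀ v ∈ C, L v ∈ coneCore C κ) (hL0 : ∀ v ∈ C, v ≠ 0 → L v ≠ 0) :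
    ∃ c > 0, ∀ w ∈ coneCore C κ', c * ‖w‖ ≤ ‖L w‖ := by
  obtain ⟨hcl, hsm, ⟨W, hW, -⟩, hrank⟩ := hC
  have h0 : (0 : X) ∈ C := hW W.zero_mem
  by_contra hcon
  push Not at hcon
  have hunit : ∀ ε > 0, ∃ w ∈ coneCore C κ', ‖w‖ = 1 ∧ ‖L w‖ < ε := by
    intro ε hε
    obtain ⟨w, hw, hlt⟩ := hcon ε hε
    have hw0 : ‖w‖ ≠ 0 := by
      intro h
      rw [h, mul_zero] at hlt
      exact absurd hlt (not_lt.2 (norm_nonneg _))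
    refine ⟨‖w‖⁻¹ • w, smul_mem_coneCore hsm hw _, ?_, ?_⟩
    · rw [norm_smul, norm_inv, norm_norm, inv_mul_cancel₀ hw0]
    · rw [map_smul, norm_smul, norm_inv, norm_norm, inv_mul_lt_iff₀ (by positivity)]
      linarith
  have hsmall : ∀ e : X, ‖e‖ < κ' → L e ∈ C := by
    intro e he
    refine hcl.closure_subset (Metric.mem_closure_iff.2 fun ε hε => ?_)
    obtain ⟨w, hw, hw1, hwε⟩ := hunit ε hε
    refine ⟨L (w + e), mem_cone_of_mem_coneCore h0 hκ
      (hL _ (add_mem_of_mem_coneCore hw (by rw [hw1, mul_one]; exact he))), ?_⟩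
    rw [dist_eq_norm, map_add]
    simpa using hwε
  have hrange : (L.range : Set X) ⊆ C := by
    rintro _ ⟨e, rfl⟩
    obtain ⟨t, ht, hte⟩ : ∃ t : ℝ, t ≠ 0 ∧ ‖t • e‖ < κ' := by
      refine ⟨κ' / (2 * (‖e‖ + 1)), by positivity, ?_⟩
      rw [norm_smul, Real.norm_of_nonneg (by positivity), div_mul_eq_mul_div,
        div_lt_iff₀ (by positivity)]
      nlinarith [norm_nonneg e]
    have := hsmall _ hte
    rw [map_smul] at this
    exact (smul_mem_cone_iff hsm ht).1 this
  have hfin : FiniteDimensional ℝ L.range := by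
    rw [FiniteDimensional, ← Module.rank_lt_aleph0_iff]
    exact lt_of_le_of_lt (hrank _ hrange) Cardinal.natCast_lt_aleph0
  have hcomp : CompleteSpace L.range := FiniteDimensional.complete ℝ _
  obtain ⟨K, hK, hpre⟩ := L.rangeRestrict.exists_preimage_norm_le
    (LinearMap.surjective_rangeRestrict _)
  set m := min κ' 1 with hm
  have hm0 : 0 < m := lt_min hκ' one_pos
  obtain ⟨w, hw, hw1, hwε⟩ := hunit (m / K) (by positivity)
  obtain ⟨e, he, hen⟩ := hpre (L.rangeRestrict w)
  have hLe : L e = L w := congrArg Subtype.val he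
  have hen' : ‖e‖ < m := by
    refine hen.trans_lt ?_
    have : ‖L.rangeRestrict w‖ = ‖L w‖ := rfl
    rw [this]
    rwa [lt_div_iff₀ hK, mul_comm] at hwε
  have hmem : w + -e ∈ C := add_mem_of_mem_coneCore hw (by
    rw [norm_neg, hw1, mul_one]; exact hen'.trans_le (min_le_left _ _))
  by_cases hz : w + -e = 0
  · have : w = e := by rwa [← sub_eq_add_neg, sub_eq_zero] at hz
    rw [this] at hw1
    exact absurd (hw1 ▸ hen') (not_lt.2 (min_le_right _ _))
  · exact hL0 _ hmem hz (by simp [hLe])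

/-- One step of the growth of the segment `v + s u` staying in the core of the cone. -/
lemma exists_ball_growth (hsm : ∀ (t : ℝ) (v : X), v ∈ C → t • v ∈ C) (h0 : (0 : X) ∈ C)
    {κ c : ℝ} (hκ : 0 < κ) (hκ1 : κ ≤ 1) (hc : 0 < c) {F : X → X} {L : X →L[ℝ] X} {z : X}
    (hF : HasStrictFDerivAt F L z) (hmono : ∀ a b, a - b ∈ C → F a - F b ∈ C)
    (hL : ∀ v ∈ C, L v ∈ coneCore C κ)
    (hLc : ∀ w ∈ coneCore C (κ / 2), c * ‖w‖ ≤ ‖L w‖) :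
    ∃ r > 0, ∀ a ∈ ball z r, ∀ b ∈ ball z r, ∀ d ∈ ball z r, ∀ σ : ℝ, 0 ≤ σ →
      (∀ s : ℝ, |s| ≤ σ → (b - a) + s • (d - a) ∈ coneCore C (κ / 2)) → F d - F a ∉ C →
      ∀ s : ℝ, |s| ≤ (1 + 3 * κ ^ 2 / 32) * σ →
        (F b - F a) + s • (F d - F a) ∈ coneCore C (κ / 2) := by
  set ε : ℝ := c * κ ^ 2 / 32 with hε
  have hε0 : 0 < ε := by positivity
  have hstrict := (hasStrictFDerivAt_iff_isLittleO.1 hF).def hε0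
  obtain ⟨r, hr, hball⟩ := Metric.eventually_nhds_iff_ball.1 hstrict
  have hdiff : ∀ a ∈ ball z r, ∀ b ∈ ball z r,
      ‖F b - F a - L (b - a)‖ ≤ ε * ‖b - a‖ := by
    intro a ha b hb
    exact hball (b, a) (by
      rw [← ball_prod_same]; exact ⟨hb, ha⟩)
  refine ⟨r, hr, fun a ha b hb d hd σ hσ hline hFd s hs => ?_⟩
  set v := b - a
  set u := d - a with hu_def
  set v' := F b - F a
  set u' := F d - F a
  have hu : u ∉ C := fun h => hFd (hmono _ _ h)
  have hstep : ∀ t : ℝ, |t| ≤ σ → v' + t • u' ∈ coneCore C (3 * κ / 4) := by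
    intro t ht
    obtain ⟨h1, h2⟩ := norm_le_of_line_mem_coneCore hsm (by positivity) (by linarith) hσ hu
      hline ht
    have hw := hline t ht
    have hLw := hL _ (mem_cone_of_mem_coneCore h0 (by positivity) hw)
    have hlow := hLc _ hw
    refine mem_coneCore_of_norm_sub_le (β := κ / 8) hLw ?_ (by positivity) (by nlinarith)
    have e : v' + t • u' - L (v + t • u) = (v' - L v) + t • (u' - L u) := by
      rw [map_add, map_smul, smul_sub t u' (L u)]; abel
    have h3 : ‖v' + t • u' - L (v + t • u)‖ ≤ ε * ‖v‖ + σ * (ε * ‖u‖) := by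
      rw [e]
      refine (norm_add_le _ _).trans (add_le_add (hdiff a ha b hb) ?_)
      rw [norm_smul]
      exact mul_le_mul ht (hdiff a ha d hd) (norm_nonneg _) hσ
    refine h3.trans ?_
    have h4 : κ / 2 * (ε * ‖v‖ + σ * (ε * ‖u‖)) ≤ 2 * ε * ‖v + t • u‖ := by nlinarith
    have h5 : 2 * ε * ‖v + t • u‖ ≤ κ / 2 * (κ / 8 * ‖L (v + t • u)‖) := by
      have : 2 * ε * ‖v + t • u‖ = κ ^ 2 / 16 * (c * ‖v + t • u‖) := by rw [hε]; ring
      rw [this]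
      have := mul_le_mul_of_nonneg_left hlow (by positivity : 0 ≤ κ ^ 2 / 16)
      linarith
    exact le_of_mul_le_mul_left (h4.trans h5) (by positivity)
  obtain ⟨t, ht, hst⟩ : ∃ t : ℝ, |t| ≤ σ ∧ |s - t| ≤ 3 * κ ^ 2 / 32 * σ := by
    refine ⟨max (-σ) (min s σ), abs_le.2 ⟨le_max_left _ _, max_le (by linarith) (min_le_right _ _)⟩, ?_⟩
    have hs' := abs_le.1 hs
    have : 0 ≤ 3 * κ ^ 2 / 32 * σ := by positivity
    rw [abs_le]
    rcases le_total s σ with h | h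
    · rw [min_eq_left h]
      rcases le_total (-σ) s with h' | h'
      · rw [max_eq_right h']; constructor <;> linarith
      · rw [max_eq_left h']; constructor <;> linarith
    · rw [min_eq_right h, max_eq_right (by linarith)]; constructor <;> linarith
  obtain ⟨-, h2⟩ := norm_le_of_line_mem_coneCore hsm (by positivity) (by linarith) hσ hFd
    hstep ht
  refine mem_coneCore_of_norm_sub_le (β := κ / 8) (hstep t ht) ?_ (by positivity) (by nlinarith)
  have e : v' + s • u' - (v' + t • u') = (s - t) • u' := by rw [sub_smul]; abel
  rw [e, norm_smul, Real.norm_eq_abs]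
  calc |s - t| * ‖u'‖ ≤ 3 * κ ^ 2 / 32 * σ * ‖u'‖ :=
        mul_le_mul_of_nonneg_right hst (norm_nonneg _)
    _ = κ / 8 * (3 * κ / 4 * (σ * ‖u'‖)) := by ring
    _ ≤ κ / 8 * ‖v' + t • u'‖ := mul_le_mul_of_nonneg_left h2 (by positivity)

/-- Quantitative separation along orbits of `F`: a difference `b - a` in the core of the cone
grows exponentially relative to a difference `d - a` which stays outside the cone. -/
lemma growth_iterate (hsm : ∀ (t : ℝ) (v : X), v ∈ C → t • v ∈ C)
    {κ : ℝ} (hκ : 0 < κ) (hκ1 : κ ≤ 1) {F : X → X} {P : Set X → Prop}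
    (hgrow : ∀ U, P U → ∀ a ∈ U, ∀ b ∈ U, ∀ d ∈ U, ∀ σ : ℝ, 0 ≤ σ →
      (∀ s : ℝ, |s| ≤ σ → (b - a) + s • (d - a) ∈ coneCore C (κ / 2)) → F d - F a ∉ C →
      ∀ s : ℝ, |s| ≤ (1 + 3 * κ ^ 2 / 32) * σ →
        (F b - F a) + s • (F d - F a) ∈ coneCore C (κ / 2))
    {a b d : ℕ → X} {J : ℕ} (ha : ∀ j < J, a (j + 1) = F (a j))
    (hb : ∀ j < J, b (j + 1) = F (b j)) (hd : ∀ j < J, d (j + 1) = F (d j))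
    (hU : ∀ j < J, ∃ U, P U ∧ a j ∈ U ∧ b j ∈ U ∧ d j ∈ U)
    (hun : ∀ j ≤ J, d j - a j ∉ C) (hinit : b 0 - a 0 ∈ coneCore C κ) (h0 : (0 : X) ∈ C) :
    κ ^ 2 / 16 * (1 + 3 * κ ^ 2 / 32) ^ J * ‖b 0 - a 0‖ * ‖d J - a J‖ ≤
        ‖b J - a J‖ * ‖d 0 - a 0‖ ∧
      (b J - d J ∉ C →
        κ ^ 2 / 16 * (1 + 3 * κ ^ 2 / 32) ^ J * ‖b 0 - a 0‖ ≤ ‖d 0 - a 0‖) := by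
  have hu0 : 0 < ‖d 0 - a 0‖ := norm_pos_iff.2 fun h => hun 0 (Nat.zero_le _) (h ▸ h0)
  set σ₀ : ℝ := κ / 8 * ‖b 0 - a 0‖ / ‖d 0 - a 0‖ with hσ₀
  have hσ₀0 : 0 ≤ σ₀ := by positivity
  set Λ : ℝ := 1 + 3 * κ ^ 2 / 32
  have hΛ : 0 ≤ Λ := by positivity
  have main : ∀ j ≤ J, ∀ s : ℝ, |s| ≤ Λ ^ j * σ₀ →
      (b j - a j) + s • (d j - a j) ∈ coneCore C (κ / 2) := by
    intro j
    induction j with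
    | zero =>
      intro _ s hs
      refine mem_coneCore_of_norm_sub_le (β := κ / 8) hinit ?_ (by positivity) (by nlinarith)
      rw [pow_zero, one_mul, hσ₀, le_div_iff₀ hu0] at hs
      simpa [norm_smul] using hs
    | succ j ih =>
      intro hj s hs
      obtain ⟨U, hPU, haU, hbU, hdU⟩ := hU j hj
      have hun' := hun (j + 1) hj
      rw [hd j hj, ha j hj] at hun' ⊢
      rw [hb j hj]
      refine hgrow U hPU _ haU _ hbU _ hdU (Λ ^ j * σ₀) (by positivity) (ih (by omega)) hun' s ?_
      rwa [← mul_assoc, ← pow_succ']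
  have hJ := main J le_rfl
  constructor
  · obtain ⟨-, h2⟩ := norm_le_of_line_mem_coneCore hsm (by positivity) (by linarith)
      (by positivity : 0 ≤ Λ ^ J * σ₀) (hun J le_rfl) hJ (s := 0) (by simp; positivity)
    rw [zero_smul, add_zero] at h2
    calc κ ^ 2 / 16 * Λ ^ J * ‖b 0 - a 0‖ * ‖d J - a J‖
        = (κ / 2 * (Λ ^ J * σ₀ * ‖d J - a J‖)) * ‖d 0 - a 0‖ := by
          rw [hσ₀]; field_simp; ring
      _ ≤ ‖b J - a J‖ * ‖d 0 - a 0‖ := mul_le_mul_of_nonneg_right h2 hu0.le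
  · intro hbd
    have hlt : Λ ^ J * σ₀ < 1 := by
      by_contra hge
      push Not at hge
      have := mem_cone_of_mem_coneCore h0 (by positivity) (hJ (-1) (by simpa using hge))
      apply hbd
      have e : b J - a J + (-1 : ℝ) • (d J - a J) = b J - d J := by
        rw [neg_one_smul]; abel
      rwa [e] at this
    have h3 : Λ ^ J * (κ / 8 * ‖b 0 - a 0‖) ≤ ‖d 0 - a 0‖ := by
      rw [hσ₀, ← mul_div_assoc, div_lt_one hu0] at hlt
      exact hlt.le
    have h4 : 0 ≤ Λ ^ J * ‖b 0 - a 0‖ := by positivity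
    nlinarith

end Cone

section OmegaLimit

variable {X : Type*} [NormedAddCommGroup X] [NormedSpace ℝ X]

lemma Semiflow.tendsto_toFun (Φ : Semiflow X) {ι : Type*} {l : Filter ι} {s : ι → ℝ} {y : ι → X}
    {t : ℝ} {z : X} (ht : 0 ≤ t) (hs : Tendsto s l (nhds t)) (hs0 : ∀ᶠ i in l, 0 ≤ s i)
    (hy : Tendsto y l (nhds z)) :
    Tendsto (fun i => Φ.toFun (s i) (y i)) l (nhds (Φ.toFun t z)) := by
  have h : Tendsto (fun p : ℝ × X => Φ.toFun p.1 p.2)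
      (nhdsWithin (t, z) (Ici (0 : ℝ) ×ˢ univ)) (nhds (Φ.toFun t z)) :=
    Φ.cont (t, z) ⟨ht, mem_univ _⟩
  exact h.comp (tendsto_nhdsWithin_iff.2
    ⟨hs.prodMk_nhds hy, hs0.mono fun i hi => ⟨hi, mem_univ _⟩⟩)

lemma Semiflow.continuous_toFun (Φ : Semiflow X) {t : ℝ} (ht : 0 ≤ t) :
    Continuous (Φ.toFun t) :=
  continuous_iff_continuousAt.2 fun _ =>
    Φ.tendsto_toFun ht tendsto_const_nhds (Eventually.of_forall fun _ => ht) tendsto_id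

lemma mem_omegaSet_of_tendsto {Φ : Semiflow X} {x y : X} {ι : Type*} {l : Filter ι} [l.NeBot]
    {u : ι → ℝ} (hu : Tendsto u l atTop) (h : Tendsto (fun i => Φ.toFun (u i) x) l (nhds y)) :
    y ∈ omegaSet Φ x := by
  refine mem_iInter₂.2 fun s _ => mem_closure_of_tendsto h ?_
  filter_upwards [hu.eventually_ge_atTop s] with i hi
  exact ⟨_, hi, rfl⟩

lemma exists_seq_tendsto_of_mem_omegaSet {Φ : Semiflow X} {x y : X} (hy : y ∈ omegaSet Φ x) :
    ∃ u : ℕ → ℝ, Tendsto u atTop atTop ∧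
      Tendsto (fun n => Φ.toFun (u n) x) atTop (nhds y) := by
  have h : ∀ n : ℕ, ∃ t : ℝ, (n : ℝ) ≤ t ∧ dist (Φ.toFun t x) y < 1 / ((n : ℝ) + 1) := by
    intro n
    obtain ⟨_, ⟨t, ht, rfl⟩, hd⟩ := Metric.mem_closure_iff.1
      (mem_iInter₂.1 hy n (mem_Ici.2 (Nat.cast_nonneg n))) (1 / ((n : ℝ) + 1)) (by positivity)
    exact ⟨t, ht, by rwa [dist_comm]⟩
  choose u hu hd using h
  exact ⟨u, tendsto_atTop_mono hu tendsto_natCast_atTop_atTop,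
    tendsto_iff_dist_tendsto_zero.2 (squeeze_zero (fun _ => dist_nonneg) (fun n => (hd n).le)
      tendsto_one_div_add_atTop_nhds_zero_nat)⟩

lemma isCompact_omegaSet {Φ : Semiflow X} {x : X} (h : IsCompact (closure (posOrbit Φ x))) :
    IsCompact (omegaSet Φ x) := by
  refine h.of_isClosed_subset (isClosed_biInter fun _ _ => isClosed_closure)
    ((biInter_subset_of_mem (mem_Ici.2 le_rfl)).trans (closure_mono ?_))
  rintro y ⟨t, ht, rfl⟩
  exact ⟨t, ht, rfl⟩

/-- A precompact semiorbit of a semiflow strongly monotone with respect to a cone `C`, together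
with a flow extension `ψ` on its ω-limit set. -/
structure MonotoneOrbit (Φ : Semiflow X) (C : Set X) (x : X) (ψ : ℝ → X → X) : Prop where
  closed : IsClosed C
  smul_mem : ∀ (t : ℝ) (v : X), v ∈ C → t • v ∈ C
  zero_mem : (0 : X) ∈ C
  zero_notMem : (0 : X) ∉ interior C
  mono : StronglyMonotone Φ C
  compact : IsCompact (closure (posOrbit Φ x))
  flow : IsFlowExtensionOn Φ ψ (omegaSet Φ x)

namespace MonotoneOrbit

variable {Φ : Semiflow X} {C : Set X} {x : X} {ψ : ℝ → X → X}

lemma psi_mem (h : MonotoneOrbit Φ C x ψ) (t : ℝ) {z : X} (hz : z ∈ omegaSet Φ x) :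
    ψ t z ∈ omegaSet Φ x := h.flow.2.1 t z hz

lemma psi_psi (h : MonotoneOrbit Φ C x ψ) (s t : ℝ) {z : X} (hz : z ∈ omegaSet Φ x) :
    ψ s (ψ t z) = ψ (s + t) z := h.flow.2.2.1 s t z hz

lemma psi_eq (h : MonotoneOrbit Φ C x ψ) {t : ℝ} (ht : 0 ≤ t) {z : X}
    (hz : z ∈ omegaSet Φ x) : ψ t z = Φ.toFun t z := h.flow.1 t ht z hz

lemma psi_zero (h : MonotoneOrbit Φ C x ψ) {z : X} (hz : z ∈ omegaSet Φ x) : ψ 0 z = z := by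
  rw [h.psi_eq le_rfl hz, Φ.map_zero]

lemma psi_neg_psi (h : MonotoneOrbit Φ C x ψ) (s : ℝ) {z : X} (hz : z ∈ omegaSet Φ x) :
    ψ (-s) (ψ s z) = z := by
  rw [h.psi_psi _ _ hz, neg_add_cancel, h.psi_zero hz]

lemma psi_psi_neg (h : MonotoneOrbit Φ C x ψ) (s : ℝ) {z : X} (hz : z ∈ omegaSet Φ x) :
    ψ s (ψ (-s) z) = z := by
  rw [h.psi_psi _ _ hz, add_neg_cancel, h.psi_zero hz]

lemma tendsto_psi (h : MonotoneOrbit Φ C x ψ) {ι : Type*} {l : Filter ι} {s : ι → ℝ} {y : ι → X}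
    {t : ℝ} {z : X} (hs : Tendsto s l (nhds t)) (hy : Tendsto y l (nhds z))
    (hyω : ∀ᶠ i in l, y i ∈ omegaSet Φ x) (hz : z ∈ omegaSet Φ x) :
    Tendsto (fun i => ψ (s i) (y i)) l (nhds (ψ t z)) := by
  have h : Tendsto (fun p : ℝ × X => ψ p.1 p.2)
      (nhdsWithin (t, z) (univ ×ˢ omegaSet Φ x)) (nhds (ψ t z)) :=
    h.flow.2.2.2 (t, z) ⟨mem_univ _, hz⟩
  exact h.comp (tendsto_nhdsWithin_iff.2
    ⟨hs.prodMk_nhds hy, hyω.mono fun i hi => ⟨mem_univ _, hi⟩⟩)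

lemma continuous_psi (h : MonotoneOrbit Φ C x ψ) {z : X} (hz : z ∈ omegaSet Φ x) :
    Continuous fun t => ψ t z :=
  continuous_iff_continuousAt.2 fun _ =>
    h.tendsto_psi tendsto_id tendsto_const_nhds (Eventually.of_forall fun _ => hz) hz

lemma isCompact_omegaSet (h : MonotoneOrbit Φ C x ψ) : IsCompact (omegaSet Φ x) :=
  _root_.isCompact_omegaSet h.compact

lemma exists_tendsto (h : MonotoneOrbit Φ C x ψ) {ι : Type*} (l : Ultrafilter ι) {u : ι → ℝ}
    (hu : Tendsto u l atTop) :
    ∃ y ∈ omegaSet Φ x, Tendsto (fun i => Φ.toFun (u i) x) l (nhds y) := by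
  obtain ⟨y, -, hy⟩ := h.compact.ultrafilter_le_nhds (l.map fun i => Φ.toFun (u i) x) (by
    rw [le_principal_iff]
    change ∀ᶠ i in (l : Filter ι), Φ.toFun (u i) x ∈ closure (posOrbit Φ x)
    filter_upwards [hu.eventually_ge_atTop 0] with i hi
    exact subset_closure ⟨u i, hi, rfl⟩)
  exact ⟨y, mem_omegaSet_of_tendsto hu hy, hy⟩

lemma exists_tendsto_of_mem (h : MonotoneOrbit Φ C x ψ) {ι : Type*} (l : Ultrafilter ι)
    {y : ι → X} (hy : ∀ i, y i ∈ omegaSet Φ x) :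
    ∃ z ∈ omegaSet Φ x, Tendsto y l (nhds z) := by
  obtain ⟨z, hz, hyz⟩ := h.isCompact_omegaSet.ultrafilter_le_nhds (l.map y) (by
    rw [le_principal_iff]
    exact Eventually.of_forall (f := (l : Filter ι)) hy)
  exact ⟨z, hz, hyz⟩

lemma tendsto_shift (h : MonotoneOrbit Φ C x ψ) {ι : Type*} {l : Filter ι}
    {u : ι → ℝ} (hu : Tendsto u l atTop) {y : X} (hyω : y ∈ omegaSet Φ x)
    (hy : Tendsto (fun i => Φ.toFun (u i) x) l (nhds y)) (s : ℝ) :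
    Tendsto (fun i => Φ.toFun (u i + s) x) l (nhds (ψ s y)) := by
  have pos : ∀ (g : Filter ι) (w : ι → ℝ) (z : X), Tendsto w g atTop → z ∈ omegaSet Φ x →
      Tendsto (fun i => Φ.toFun (w i) x) g (nhds z) → ∀ r : ℝ, 0 ≤ r →
      Tendsto (fun i => Φ.toFun (w i + r) x) g (nhds (ψ r z)) := by
    intro g w z hw hz hwz r hr
    rw [h.psi_eq hr hz]
    refine (((Φ.continuous_toFun hr).tendsto z).comp hwz).congr' ?_
    filter_upwards [hw.eventually_ge_atTop 0] with i hi
    rw [add_comm, Φ.map_add r _ hr hi]; rfl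
  rcases le_total 0 s with hs | hs
  · exact pos l u y hu hyω hy s hs
  · refine tendsto_iff_ultrafilter _ _ _ |>.2 fun g hg => ?_
    have hus : Tendsto (fun i => u i + s) g atTop :=
      tendsto_atTop_add_const_right _ _ (hu.mono_left hg)
    obtain ⟨y', hy', hlim⟩ := h.exists_tendsto g hus
    have h2 := pos g _ y' hus hy' hlim (-s) (by linarith)
    simp only [add_neg_cancel_right] at h2
    have h3 : ψ (-s) y' = y := tendsto_nhds_unique h2 (hy.mono_left hg)
    have h4 : ψ s y = y' := by rw [← h3, h.psi_psi_neg _ hy']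
    rwa [h4]

lemma invariant_omegaSet (h : MonotoneOrbit Φ C x ψ) : Invariant Φ (omegaSet Φ x) := by
  intro t ht
  apply Subset.antisymm
  · rintro _ ⟨z, hz, rfl⟩
    rw [← h.psi_eq ht hz]; exact h.psi_mem t hz
  · intro z hz
    exact ⟨ψ (-t) z, h.psi_mem _ hz, by rw [← h.psi_eq ht (h.psi_mem _ hz), h.psi_psi_neg t hz]⟩

/-- Ordered points of the ω-limit set have equal or strongly ordered forward images. -/
lemma psi_eq_or_mem_interior (h : MonotoneOrbit Φ C x ψ) {a b : X} (ha : a ∈ omegaSet Φ x)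
    (hb : b ∈ omegaSet Φ x) {t : ℝ} (ht : 0 < t) (hab : ψ (-t) a - ψ (-t) b ∈ C) :
    a = b ∨ a - b ∈ interior C := by
  by_cases he : ψ (-t) a = ψ (-t) b
  · left; rw [← h.psi_psi_neg t ha, he, h.psi_psi_neg t hb]
  · right
    have := h.mono.2 t ht _ _ hab he
    rwa [← h.psi_eq ht.le (h.psi_mem _ ha), ← h.psi_eq ht.le (h.psi_mem _ hb),
      h.psi_psi_neg t ha, h.psi_psi_neg t hb] at this

/-- A pseudo-ordered orbit is eventually strongly ordered with one of its time shifts. -/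
lemma exists_shift_mem_interior (h : MonotoneOrbit Φ C x ψ) (hpo : PseudoOrdered Φ C x) :
    ∃ τ > 0, ∃ t₀, 0 ≤ t₀ ∧ ∀ t > t₀, Φ.toFun t x - Φ.toFun (t + τ) x ∈ interior C := by
  have key : ∀ t₁ t₂ : ℝ, 0 ≤ t₁ → t₁ < t₂ → Φ.toFun t₁ x ≠ Φ.toFun t₂ x →
      Φ.toFun t₁ x - Φ.toFun t₂ x ∈ C →
      ∃ τ > 0, ∃ t₀, 0 ≤ t₀ ∧ ∀ t > t₀, Φ.toFun t x - Φ.toFun (t + τ) x ∈ interior C := by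
    intro t₁ t₂ h₁ h₁₂ hne hC
    refine ⟨t₂ - t₁, by linarith, t₁, h₁, fun t ht => ?_⟩
    have := h.mono.2 (t - t₁) (by linarith) _ _ hC hne
    rw [← Φ.map_add _ _ (by linarith) h₁, ← Φ.map_add _ _ (by linarith) (by linarith)] at this
    convert this using 3 <;> ring
  obtain ⟨t₁, t₂, h₁, h₂, hne, hC⟩ := hpo
  rcases lt_trichotomy t₁ t₂ with hlt | rfl | hlt
  · exact key t₁ t₂ h₁ hlt hne hC
  · exact absurd rfl hne
  · exact key t₂ t₁ h₂ hlt hne.symm ((sub_mem_cone_comm h.smul_mem).1 hC)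

/-- If the orbit is strongly ordered with one of its shifts, then every orbit in the ω-limit set
is ordered. -/
lemma sub_psi_mem_cone (h : MonotoneOrbit Φ C x ψ) {τ t₀ : ℝ} (hτ : 0 < τ) (ht₀ : 0 ≤ t₀)
    (hsh : ∀ t > t₀, Φ.toFun t x - Φ.toFun (t + τ) x ∈ interior C) {z : X}
    (hz : z ∈ omegaSet Φ x) {s : ℝ} (hs : 0 < s) : z - ψ s z ∈ C := by
  set A : Set ℝ := {s | 0 < s ∧ ∃ t, 0 ≤ t ∧ Φ.toFun t x - Φ.toFun (t + s) x ∈ interior C}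
    with hA
  have hAopen : IsOpen A := by
    rw [isOpen_iff_mem_nhds]
    rintro c ⟨hc, t, ht, hcC⟩
    have h1 : Tendsto (fun s => Φ.toFun t x - Φ.toFun (t + s) x) (nhds c)
        (nhds (Φ.toFun t x - Φ.toFun (t + c) x)) := by
      refine tendsto_const_nhds.sub (Φ.tendsto_toFun (by linarith)
        (tendsto_const_nhds.add tendsto_id) ?_ tendsto_const_nhds)
      filter_upwards [lt_mem_nhds hc] with s hs
      linarith
    filter_upwards [lt_mem_nhds hc, h1 (isOpen_interior.mem_nhds hcC)] with s hs hsC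
    exact ⟨hs, t, ht, hsC⟩
  have hτA : τ ∈ A := ⟨hτ, t₀ + 1, by linarith, hsh _ (by linarith)⟩
  have hAsub : ∀ s ∈ A, z - ψ s z ∈ C := by
    rintro s ⟨hs, t, ht, hC⟩
    obtain ⟨u, hu, hlim⟩ := exists_seq_tendsto_of_mem_omegaSet hz
    refine h.closed.mem_of_tendsto (hlim.sub (h.tendsto_shift hu hz hlim s)) ?_
    filter_upwards [hu.eventually_ge_atTop t] with n hn
    have := h.mono.1 (u n - t) (by linarith) _ _ (interior_subset hC)
    rw [← Φ.map_add _ _ (by linarith) ht, ← Φ.map_add _ _ (by linarith) (by linarith)] at this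
    convert this using 3 <;> ring
  have hret : ∀ c > 0, z - ψ c z ∈ C → (∀ ε > 0, ∃ s > 0, |s - c| < ε ∧ z - ψ s z ∉ C) →
      ψ c z = z := by
    intro c hc hcC hcl
    by_contra hne
    have hint := h.mono.2 1 one_pos _ _ hcC (Ne.symm hne)
    rw [← h.psi_eq zero_le_one hz, ← h.psi_eq zero_le_one (h.psi_mem c hz),
      h.psi_psi _ _ hz, add_comm 1 c, ← h.psi_psi c 1 hz] at hint
    obtain ⟨u, hu, hlim⟩ := exists_seq_tendsto_of_mem_omegaSet (h.psi_mem 1 hz)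
    have hlim2 := hlim.sub (h.tendsto_shift hu (h.psi_mem 1 hz) hlim c)
    obtain ⟨n, hn, hn0⟩ := ((hlim2.eventually (isOpen_interior.mem_nhds hint)).and
      (hu.eventually_ge_atTop 0)).exists
    have hcA : c ∈ A := ⟨hc, u n, hn0, hn⟩
    obtain ⟨ε, hε, hball⟩ := Metric.isOpen_iff.1 hAopen c hcA
    obtain ⟨s, hs, hsc, hsC⟩ := hcl ε hε
    exact hsC (hAsub s (hball (by rwa [mem_ball, Real.dist_eq])))
  by_contra hsC
  have hPcl : IsClosed {s : ℝ | z - ψ s z ∈ C} :=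
    h.closed.preimage (continuous_const.sub (h.continuous_psi hz))
  obtain ⟨c₁, ⟨⟨hc₁0, hc₁s⟩, hc₁P⟩, hc₁max⟩ := (isCompact_Icc.inter_right hPcl).exists_isGreatest
    (⟨0, ⟨left_mem_Icc.2 hs.le, by simpa [h.psi_zero hz] using h.zero_mem⟩⟩ :
      (Icc 0 s ∩ {s : ℝ | z - ψ s z ∈ C}).Nonempty)
  have hc₁lt : c₁ < s := lt_of_le_of_ne hc₁s (by rintro rfl; exact hsC hc₁P)
  have hV₁ : ∀ t, c₁ < t → t ≤ s → z - ψ t z ∉ C := fun t ht hts htC =>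
    absurd (hc₁max ⟨⟨hc₁0.trans ht.le, hts⟩, htC⟩) (not_le.2 ht)
  have hc₁z : ψ c₁ z = z := by
    rcases hc₁0.eq_or_lt with h0 | h0
    · rw [← h0, h.psi_zero hz]
    · refine hret c₁ h0 hc₁P fun ε hε => ?_
      have hm : 0 < min (ε / 2) (s - c₁) := lt_min (by linarith) (by linarith)
      have hm1 := min_le_left (ε / 2) (s - c₁)
      have hm2 := min_le_right (ε / 2) (s - c₁)
      refine ⟨c₁ + min (ε / 2) (s - c₁), by linarith, ?_, hV₁ _ (by linarith) (by linarith)⟩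
      rw [add_sub_cancel_left, abs_of_pos hm]; linarith
  have hV₂ : ∀ t, 0 < t → t ≤ s - c₁ → z - ψ t z ∉ C := by
    intro t ht hts
    have := hV₁ (t + c₁) (by linarith) (by linarith)
    rwa [← h.psi_psi _ _ hz, hc₁z] at this
  have hτℓ : s - c₁ < τ := by
    by_contra hle
    exact hV₂ τ hτ (not_lt.1 hle) (hAsub τ hτA)
  obtain ⟨c₂, ⟨⟨hc₂0, hc₂τ⟩, hc₂P⟩, hc₂min⟩ := (isCompact_Icc.inter_right hPcl).exists_isLeast
    (⟨τ, ⟨right_mem_Icc.2 hτℓ.le, hAsub τ hτA⟩⟩ :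
      (Icc (s - c₁) τ ∩ {s : ℝ | z - ψ s z ∈ C}).Nonempty)
  have hc₂pos : 0 < c₂ := by linarith
  have hV₃ : ∀ t, 0 < t → t < c₂ → z - ψ t z ∉ C := by
    intro t ht htc htC
    rcases le_total t (s - c₁) with hle | hle
    · exact hV₂ t ht hle htC
    · exact absurd (hc₂min ⟨⟨hle, by linarith⟩, htC⟩) (not_le.2 htc)
  have hc₂z : ψ c₂ z = z := by
    refine hret c₂ hc₂pos hc₂P fun ε hε => ?_
    have hm : 0 < min (ε / 2) (c₂ / 2) := lt_min (by linarith) (by linarith)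
    have hm1 := min_le_left (ε / 2) (c₂ / 2)
    have hm2 := min_le_right (ε / 2) (c₂ / 2)
    refine ⟨c₂ - min (ε / 2) (c₂ / 2), by linarith, ?_, hV₃ _ (by linarith) (by linarith)⟩
    rw [sub_sub_cancel_left, abs_neg, abs_of_pos hm]; linarith
  have hper : ∀ m : ℕ, ψ (m * c₂) z = z := by
    intro m
    induction m with
    | zero => simpa using h.psi_zero hz
    | succ m ih => rw [Nat.cast_succ, add_mul, one_mul, ← h.psi_psi _ _ hz, hc₂z, ih]
  set m := ⌊τ / c₂⌋₊ with hm
  have hm1 : m * c₂ ≤ τ := by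
    rw [← le_div_iff₀ hc₂pos]; exact Nat.floor_le (by positivity)
  have hm2 : τ < (m + 1) * c₂ := by
    rw [← div_lt_iff₀ hc₂pos]; exact Nat.lt_floor_add_one _
  obtain ⟨ε, hε, hball⟩ := Metric.isOpen_iff.1 hAopen τ hτA
  obtain ⟨e, he0, he⟩ := exists_between (lt_min hε (by linarith : 0 < (m + 1) * c₂ - τ))
  have he1 := he.trans_le (min_le_left _ _)
  have he2 := he.trans_le (min_le_right _ _)
  have hmem := hAsub (τ + e) (hball (by
    rw [mem_ball, Real.dist_eq, add_sub_cancel_left, abs_of_pos he0]; exact he1))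
  have : ψ (τ + e) z = ψ (τ + e - m * c₂) z := by
    conv_rhs => rw [← hper m, h.psi_psi _ _ hz, sub_add_cancel]
  rw [this] at hmem
  exact hV₃ _ (by linarith) (by linarith) hmem

/-- Under the same assumption, distinct points of an orbit in the ω-limit set are strongly
ordered. -/
lemma psi_eq_self_or_mem_interior (h : MonotoneOrbit Φ C x ψ) {τ t₀ : ℝ} (hτ : 0 < τ)
    (ht₀ : 0 ≤ t₀) (hsh : ∀ t > t₀, Φ.toFun t x - Φ.toFun (t + τ) x ∈ interior C) {z : X}
    (hz : z ∈ omegaSet Φ x) {s : ℝ} (hs : 0 ≤ s) : ψ s z = z ∨ ψ s z - z ∈ interior C := by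
  rcases hs.eq_or_lt with rfl | hs
  · exact Or.inl (h.psi_zero hz)
  refine h.psi_eq_or_mem_interior (h.psi_mem s hz) hz one_pos ?_
  have := h.sub_psi_mem_cone hτ ht₀ hsh (h.psi_mem (-1) hz) hs
  rwa [h.psi_psi _ _ hz, sub_mem_cone_comm h.smul_mem, add_comm, ← h.psi_psi _ _ hz] at this

end MonotoneOrbit

end OmegaLimit

section GrowthSet

variable {X : Type*} [NormedAddCommGroup X] [NormedSpace ℝ X]

/-- On `U` the map `F` sends ordered pairs into the core of the cone, and enlarges the segments
`v + s u` in the core, where `v = b - a`, and `u = d - a` has image outside the cone. -/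
def GrowthSet (C : Set X) (κ : ℝ) (F : X → X) (U : Set X) : Prop :=
  (∀ a ∈ U, ∀ b ∈ U, ∀ d ∈ U, ∀ σ : ℝ, 0 ≤ σ →
      (∀ s : ℝ, |s| ≤ σ → (b - a) + s • (d - a) ∈ coneCore C (κ / 2)) → F d - F a ∉ C →
      ∀ s : ℝ, |s| ≤ (1 + 3 * κ ^ 2 / 32) * σ →
        (F b - F a) + s • (F d - F a) ∈ coneCore C (κ / 2)) ∧
    ∀ a ∈ U, ∀ b ∈ U, a - b ∈ C → F a - F b ∈ coneCore C κ

lemma GrowthSet.subset {C : Set X} {κ : ℝ} {F : X → X} {U V : Set X} (h : GrowthSet C κ F V)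
    (hUV : U ⊆ V) : GrowthSet C κ F U :=
  ⟨fun a ha b hb d hd => h.1 a (hUV ha) b (hUV hb) d (hUV hd),
    fun a ha b hb => h.2 a (hUV ha) b (hUV hb)⟩

variable {Φ : Semiflow X} {C : Set X} {x : X} {ψ : ℝ → X → X}

/-- Some multiple of a given time step makes all small balls around points of the ω-limit set
growth sets. -/
lemma MonotoneOrbit.exists_growthSet_ball [CompleteSpace X] (h : MonotoneOrbit Φ C x ψ) {k : ℕ}
    (hC : IsKCone C k) {DΦ : ℝ → X → X →L[ℝ] X} (hSFM : StronglyFocusingMonotone Φ DΦ C)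
    {τ : ℝ} (hτ : 0 < τ) :
    ∃ κ : ℝ, 0 < κ ∧ κ ≤ 1 ∧ ∃ N : ℕ, 0 < N ∧ ∃ r : ℝ, 0 < r ∧
      ∀ z ∈ omegaSet Φ x, GrowthSet C κ (Φ.toFun (N * τ)) (ball z r) := by
  obtain ⟨hder, hcont, -, hstrong, hfoc⟩ := hSFM
  obtain ⟨δ, hδ, T, hT, κ₀, hκ₀, hR⟩ := hfoc _ h.isCompact_omegaSet h.invariant_omegaSet
  set κ := min κ₀ 1 with hκdef
  have hκ : 0 < κ := lt_min hκ₀ one_pos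
  have hκ1 : κ ≤ 1 := min_le_right _ _
  have hN0 : 0 < ⌈T / τ⌉₊ := Nat.ceil_pos.2 (by positivity)
  have hNT : T ≤ ⌈T / τ⌉₊ * τ := by
    rw [← div_le_iff₀ hτ]; exact Nat.le_ceil _
  refine ⟨κ, hκ, hκ1, ⌈T / τ⌉₊, hN0, ?_⟩
  set θ : ℝ := ⌈T / τ⌉₊ * τ with hθ
  have hθ0 : 0 < θ := hT.trans_le hNT
  have hloc : ∀ z ∈ omegaSet Φ x, ∃ r > 0, ∀ a ∈ ball z r, ∀ b ∈ ball z r, a - b ∈ C →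
      Φ.toFun θ a - Φ.toFun θ b ∈ coneCore C κ := by
    intro z hz
    have hd : 0 ≤ θ - T := by linarith
    have hGz : Φ.toFun (θ - T) z ∈ omegaSet Φ x := by
      rw [← h.psi_eq hd hz]; exact h.psi_mem _ hz
    obtain ⟨r, hr, hball⟩ := Metric.mem_nhds_iff.1 ((Φ.continuous_toFun hd).continuousAt
      (closedBall_mem_nhds (Φ.toFun (θ - T) z) hδ))
    refine ⟨r, hr, fun a ha b hb hab => ?_⟩
    obtain ⟨R, hRf, hReq⟩ := hR _ hGz _ (hball ha) _ (hball hb)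
    rw [← Φ.map_add _ _ hT.le hd, ← Φ.map_add _ _ hT.le hd, add_sub_cancel] at hReq
    rw [← hReq]
    exact map_mem_coneCore_of_stronglyFocusing h.smul_mem hRf (min_le_left _ _)
      (h.mono.1 _ hd _ _ hab)
  have hderiv : ∀ z ∈ omegaSet Φ x, ∀ v ∈ C, DΦ θ z v ∈ coneCore C κ := by
    intro z hz v hv
    obtain ⟨r, hr, hball⟩ := hloc z hz
    have h1 : HasDerivAt (fun t : ℝ => Φ.toFun θ (z + t • v)) (DΦ θ z v) 0 :=
      (hder θ hθ0.le z).hasLineDerivAt v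
    rw [hasDerivAt_iff_tendsto_slope_zero] at h1
    refine (isClosed_coneCore κ).mem_of_tendsto h1 ?_
    have h2 : Tendsto (fun t : ℝ => z + t • v) (nhds 0) (nhds z) := by
      have : Tendsto (fun t : ℝ => z + t • v) (nhds 0) (nhds (z + (0 : ℝ) • v)) :=
        (continuous_const.add (continuous_id.smul continuous_const)).tendsto 0
      simpa using this
    filter_upwards [nhdsWithin_le_nhds (h2 (ball_mem_nhds z hr))] with t ht
    refine smul_mem_coneCore h.smul_mem ?_ _
    simp only [zero_add, zero_smul, add_zero]
    exact hball _ ht _ (mem_ball_self hr) (by simpa using h.smul_mem t v hv)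
  have hgood : ∀ z : omegaSet Φ x, ∃ r > 0, GrowthSet C κ (Φ.toFun θ) (ball (z : X) r) := by
    rintro ⟨z, hz⟩
    obtain ⟨r₁, hr₁, hball⟩ := hloc z hz
    obtain ⟨c, hc, hcL⟩ := exists_le_norm_map_of_mem_coneCore hC hκ (half_pos hκ)
      (hderiv z hz) (fun v hv hv0 hLv => h.zero_notMem (hLv ▸ hstrong θ hθ0 z v hv hv0))
    obtain ⟨r₂, hr₂, hgrow⟩ := exists_ball_growth h.smul_mem h.zero_mem hκ hκ1 hc
      (hasStrictFDerivAt_of_hasFDerivAt_of_continuousAt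
        (Eventually.of_forall (hder θ hθ0.le)) (hcont θ hθ0.le).continuousAt)
      (fun a b hab => h.mono.1 θ hθ0.le a b hab) (hderiv z hz) hcL
    have s₁ : ball z (min r₁ r₂) ⊆ ball z r₁ := ball_subset_ball (min_le_left _ _)
    have s₂ : ball z (min r₁ r₂) ⊆ ball z r₂ := ball_subset_ball (min_le_right _ _)
    exact ⟨min r₁ r₂, lt_min hr₁ hr₂,
      fun a ha b hb d hd => hgrow a (s₂ ha) b (s₂ hb) d (s₂ hd),
      fun a ha b hb => hball a (s₁ ha) b (s₁ hb)⟩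
  choose ρ hρ hgood using hgood
  obtain ⟨r, hr, hleb⟩ := lebesgue_number_lemma_of_metric h.isCompact_omegaSet
    (c := fun z : omegaSet Φ x => ball (z : X) (ρ z)) (fun _ => isOpen_ball)
    (fun z hz => mem_iUnion.2 ⟨⟨z, hz⟩, mem_ball_self (hρ _)⟩)
  refine ⟨r, hr, fun z hz => ?_⟩
  obtain ⟨i, hi⟩ := hleb z hz
  exact (hgood i).subset hi

end GrowthSet

/-- A nonnegative real number whose exponentially growing multiples stay bounded is zero. -/
lemma eq_zero_of_forall_pow_mul_le {c Λ v B : ℝ} (hc : 0 < c) (hΛ : 1 < Λ) (hv : 0 ≤ v)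
    (h : ∀ J : ℕ, c * Λ ^ J * v ≤ B) : v = 0 := by
  by_contra hne
  have hv0 : 0 < v := lt_of_le_of_ne hv (Ne.symm hne)
  obtain ⟨J, hJ⟩ := pow_unbounded_of_one_lt (B / (c * v)) hΛ
  rw [div_lt_iff₀ (by positivity)] at hJ
  linarith [h J]

section FocusingOrbit

variable {X : Type*} [NormedAddCommGroup X] [NormedSpace ℝ X]

/-- A monotone orbit, strongly ordered with its shift by `τ`, with strongly ordered orbits in its
ω-limit set, near which the time-`N * τ` map has quantitative growth. -/
structure FocusingOrbit (Φ : Semiflow X) (C : Set X) (x : X) (ψ : ℝ → X → X)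
    (κ τ r η t₀ : ℝ) (N : ℕ) : Prop extends MonotoneOrbit Φ C x ψ where
  ordered : ∀ z ∈ omegaSet Φ x, ∀ s : ℝ, 0 ≤ s → ψ s z = z ∨ ψ s z - z ∈ interior C
  t₀_nonneg : 0 ≤ t₀
  shift : ∀ t > t₀, Φ.toFun t x - Φ.toFun (t + τ) x ∈ interior C
  κ_pos : 0 < κ
  κ_le : κ ≤ 1
  τ_pos : 0 < τ
  N_pos : 0 < N
  r_pos : 0 < r
  η_pos : 0 < η
  growth : ∀ z ∈ omegaSet Φ x, GrowthSet C κ (Φ.toFun (N * τ)) (ball z r)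
  small : ∀ z ∈ omegaSet Φ x, ∀ s : ℝ, |s| ≤ η → dist (ψ s z) z < r

variable {Φ : Semiflow X} {C : Set X} {x : X} {ψ : ℝ → X → X}

/-- Uniform continuity of the flow on the ω-limit set at time `0`. -/
lemma MonotoneOrbit.exists_small (h : MonotoneOrbit Φ C x ψ) {r : ℝ} (hr : 0 < r) :
    ∃ η > 0, ∀ z ∈ omegaSet Φ x, ∀ s : ℝ, |s| ≤ η → dist (ψ s z) z < r := by
  by_contra hcon
  push Not at hcon
  have hn : ∀ n : ℕ, ∃ z ∈ omegaSet Φ x, ∃ s : ℝ, |s| ≤ 1 / ((n : ℝ) + 1) ∧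
      r ≤ dist (ψ s z) z := fun n => hcon _ (by positivity)
  choose z hz s hs hd using hn
  set l : Ultrafilter ℕ := Ultrafilter.of atTop
  obtain ⟨y, hy, hlim⟩ := h.exists_tendsto_of_mem l hz
  have hs0 : Tendsto s l (nhds 0) :=
    (squeeze_zero_norm hs tendsto_one_div_add_atTop_nhds_zero_nat).mono_left
      (Ultrafilter.of_le _)
  have h1 := (h.tendsto_psi hs0 hlim (Eventually.of_forall hz) hy).dist hlim
  rw [h.psi_zero hy, dist_self] at h1
  exact absurd (ge_of_tendsto' h1 hd) (not_le.2 hr)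

lemma MonotoneOrbit.psi_eq_self_of_forall_le (h : MonotoneOrbit Φ C x ψ) {z : X}
    (hz : z ∈ omegaSet Φ x) {ε : ℝ} (hε : 0 < ε) (hfix : ∀ s, 0 ≤ s → s ≤ ε → ψ s z = z)
    (s : ℝ) : ψ s z = z := by
  have pos : ∀ s, 0 ≤ s → ψ s z = z := by
    intro s hs
    obtain ⟨n, hn⟩ := exists_nat_gt (s / ε)
    have hn0 : 0 < (n : ℝ) := lt_of_le_of_lt (by positivity) hn
    have h1 : ψ (s / n) z = z := by
      refine hfix _ (by positivity) ?_
      rw [div_lt_iff₀ hε] at hn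
      rw [div_le_iff₀ hn0]; linarith
    have h2 : ∀ m : ℕ, ψ (m * (s / n)) z = z := by
      intro m
      induction m with
      | zero => simpa using h.psi_zero hz
      | succ m ih => rw [Nat.cast_succ, add_mul, one_mul, ← h.psi_psi _ _ hz, h1, ih]
    have := h2 n
    rwa [mul_div_cancel₀ _ hn0.ne'] at this
  rcases le_total 0 s with hs | hs
  · exact pos s hs
  · have := h.psi_psi_neg s hz
    rwa [pos (-s) (by linarith)] at this

lemma MonotoneOrbit.psi_eq_self_of_psi (h : MonotoneOrbit Φ C x ψ) {z : X}
    (hz : z ∈ omegaSet Φ x) {t : ℝ} (hfix : ∀ s, ψ s (ψ t z) = ψ t z) (s : ℝ) : ψ s z = z := by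
  have h1 := hfix (s - t)
  rw [h.psi_psi _ _ hz, sub_add_cancel] at h1
  have h2 := hfix (-t)
  rw [h.psi_neg_psi t hz] at h2
  rw [h1, ← h2]

namespace FocusingOrbit

variable {κ τ r η t₀ : ℝ} {N : ℕ}

lemma one_lt_factor (h : FocusingOrbit Φ C x ψ κ τ r η t₀ N) : 1 < 1 + 3 * κ ^ 2 / 32 := by
  have := h.κ_pos
  have : 0 < 3 * κ ^ 2 / 32 := by positivity
  linarith

lemma step_pos (h : FocusingOrbit Φ C x ψ κ τ r η t₀ N) : 0 < (N : ℝ) * τ :=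
  mul_pos (Nat.cast_pos.2 h.N_pos) h.τ_pos

/-- Points of an orbit in the ω-limit set are ordered. -/
lemma psi_sub_mem (h : FocusingOrbit Φ C x ψ κ τ r η t₀ N) {z : X} (hz : z ∈ omegaSet Φ x)
    (s t : ℝ) : ψ s z - ψ t z ∈ C := by
  have key : ∀ s t : ℝ, t ≤ s → ψ s z - ψ t z ∈ C := by
    intro s t hst
    have h1 := h.ordered _ (h.psi_mem t hz) (s - t) (by linarith)
    rw [h.psi_psi _ _ hz, sub_add_cancel] at h1
    rcases h1 with h1 | h1
    · rw [h1, sub_self]; exact h.zero_mem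
    · exact interior_subset h1
  rcases le_total t s with hst | hst
  · exact key s t hst
  · exact (sub_mem_cone_comm h.smul_mem).1 (key t s hst)

/-- Growth of small time shifts relative to unordered nearby points, in the ω-limit set. -/
lemma growth_psi (h : FocusingOrbit Φ C x ψ κ τ r η t₀ N) {z w : X} (hz : z ∈ omegaSet Φ x)
    (hw : w ∈ omegaSet Φ x) {s : ℝ} (hs : |s| ≤ η) {J : ℕ}
    (hun : ∀ j : ℕ, j ≤ J → ψ (j * (N * τ)) w - ψ (j * (N * τ)) z ∉ C)
    (hd : ∀ j : ℕ, j < J → dist (ψ (j * (N * τ)) w) (ψ (j * (N * τ)) z) < r)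
    (hJ : ψ (J * (N * τ) + s) z - ψ (J * (N * τ)) w ∉ C) :
    κ ^ 2 / 16 * (1 + 3 * κ ^ 2 / 32) ^ J * ‖ψ s z - z‖ ≤ ‖w - z‖ := by
  set θ : ℝ := N * τ with hθ
  have hθ0 : 0 < θ := h.step_pos
  have hcast : ∀ j : ℕ, ((j + 1 : ℕ) : ℝ) * θ = θ + j * θ := fun j => by push_cast; ring
  have hstep : ∀ (j : ℕ) {y : X}, y ∈ omegaSet Φ x →
      ψ ((j + 1 : ℕ) * θ) y = Φ.toFun θ (ψ (j * θ) y) := by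
    intro j y hy
    rw [hcast, ← h.psi_psi _ _ hy, h.psi_eq hθ0.le (h.psi_mem _ hy)]
  have hinit : ψ s z - z ∈ coneCore C κ := by
    have hy : ψ (-θ) z ∈ omegaSet Φ x := h.psi_mem _ hz
    have h1 := (h.growth _ hy).2 (ψ s (ψ (-θ) z)) (h.small _ hy s hs) (ψ (-θ) z)
      (mem_ball_self h.r_pos) (by
        simpa [h.psi_psi _ _ hz] using h.psi_sub_mem hz (s + -θ) (-θ))
    rwa [← h.psi_eq hθ0.le (h.psi_mem _ hy), ← h.psi_eq hθ0.le hy, h.psi_psi_neg _ hz,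
      h.psi_psi _ _ hz, h.psi_psi _ _ hz, add_comm s, add_neg_cancel_left] at h1
  have := (growth_iterate h.smul_mem h.κ_pos h.κ_le (F := Φ.toFun θ)
    (P := GrowthSet C κ (Φ.toFun θ)) (fun U hU => hU.1) (J := J)
    (a := fun j => ψ (j * θ) z) (b := fun j => ψ (j * θ) (ψ s z)) (d := fun j => ψ (j * θ) w)
    (fun j _ => hstep j hz) (fun j _ => hstep j (h.psi_mem s hz)) (fun j _ => hstep j hw)
    (fun j hj => ⟨_, h.growth _ (h.psi_mem (j * θ) hz), mem_ball_self h.r_pos, by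
      rw [h.psi_psi _ _ hz, add_comm, ← h.psi_psi _ _ hz]
      exact h.small _ (h.psi_mem _ hz) s hs, hd j hj⟩)
    hun (by simpa [h.psi_zero hz, h.psi_zero (h.psi_mem s hz)] using hinit) h.zero_mem).2
    (by rwa [h.psi_psi _ _ hz])
  simpa [h.psi_zero hz, h.psi_zero hw, h.psi_zero (h.psi_mem s hz)] using this

/-- Growth of the shift by `τ` along the orbit of `x`, relative to an unordered equilibrium. -/
lemma growth_orbit (h : FocusingOrbit Φ C x ψ κ τ r η t₀ N) {e : X} (he : e ∈ omegaSet Φ x)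
    (hfix : ∀ s, ψ s e = e) (hun : ∀ t, 0 ≤ t → Φ.toFun t x - e ∉ C) {t : ℝ} (ht : t₀ < t)
    {J : ℕ} (hnear : ∀ j : ℕ, j ≤ J → Φ.toFun (t + j * (N * τ)) x ∈ ball e r ∧
      Φ.toFun (t + j * (N * τ) + τ) x ∈ ball e r) :
    κ ^ 2 / 16 * (1 + 3 * κ ^ 2 / 32) ^ J *
        ‖Φ.toFun (t + N * τ + τ) x - Φ.toFun (t + N * τ) x‖ *
        ‖e - Φ.toFun (t + (J + 1 : ℕ) * (N * τ)) x‖ ≤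
      ‖Φ.toFun (t + (J + 1 : ℕ) * (N * τ) + τ) x - Φ.toFun (t + (J + 1 : ℕ) * (N * τ)) x‖ *
        ‖e - Φ.toFun (t + N * τ) x‖ ∧
    κ ^ 2 / 16 * (1 + 3 * κ ^ 2 / 32) ^ J *
        ‖Φ.toFun (t + N * τ + τ) x - Φ.toFun (t + N * τ) x‖ ≤ ‖e - Φ.toFun (t + N * τ) x‖ := by
  set θ : ℝ := N * τ with hθ
  have hθ0 : 0 < θ := h.step_pos
  have hτ := h.τ_pos
  have ht0 : 0 ≤ t := h.t₀_nonneg.trans ht.le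
  have hunt : ∀ s, 0 ≤ s → e - Φ.toFun s x ∉ C := fun s hs hC =>
    hun s hs ((sub_mem_cone_comm h.smul_mem).1 hC)
  have hcast : ∀ j : ℕ, t + ((j + 1 : ℕ) : ℝ) * θ = θ + (t + j * θ) := fun j => by
    push_cast; ring
  have hjθ : ∀ j : ℕ, 0 ≤ t + (j : ℝ) * θ := fun j => by positivity
  have hstep : ∀ j : ℕ, Φ.toFun (t + (j + 1 : ℕ) * θ) x = Φ.toFun θ (Φ.toFun (t + j * θ) x) :=
    fun j => by rw [hcast, Φ.map_add _ _ hθ0.le (hjθ j)]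
  have hstep' : ∀ j : ℕ, Φ.toFun (t + (j + 1 : ℕ) * θ + τ) x =
      Φ.toFun θ (Φ.toFun (t + j * θ + τ) x) :=
    fun j => by rw [hcast, add_assoc, Φ.map_add _ _ hθ0.le (add_nonneg (hjθ j) hτ.le)]
  have hfixθ : e = Φ.toFun θ e := by rw [← h.psi_eq hθ0.le he, hfix]
  have hinit : Φ.toFun (t + (0 + 1 : ℕ) * θ + τ) x - Φ.toFun (t + (0 + 1 : ℕ) * θ) x ∈
      coneCore C κ := by
    rw [hstep, hstep']
    refine (h.growth e he).2 _ (hnear 0 (Nat.zero_le _)).2 _ (hnear 0 (Nat.zero_le _)).1 ?_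
    rw [sub_mem_cone_comm h.smul_mem]
    simpa using interior_subset (h.shift t ht)
  have := growth_iterate h.smul_mem h.κ_pos h.κ_le (F := Φ.toFun θ)
    (P := GrowthSet C κ (Φ.toFun θ)) (fun U hU => hU.1) (J := J)
    (a := fun j => Φ.toFun (t + (j + 1 : ℕ) * θ) x)
    (b := fun j => Φ.toFun (t + (j + 1 : ℕ) * θ + τ) x) (d := fun _ => e)
    (fun j _ => hstep (j + 1)) (fun j _ => hstep' (j + 1)) (fun _ _ => hfixθ)
    (fun j hj => ⟨_, h.growth e he, (hnear (j + 1) hj).1, (hnear (j + 1) hj).2,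
      mem_ball_self h.r_pos⟩)
    (fun j _ => hunt _ (hjθ (j + 1))) hinit h.zero_mem
  have e1 : ((0 + 1 : ℕ) : ℝ) * θ = θ := by simp
  simp only [e1] at this
  exact ⟨this.1, this.2 (hun _ (add_nonneg (hjθ (J + 1)) hτ.le))⟩

/-- An equilibrium in the ω-limit set is unordered with the orbit of `x`, or strongly ordered with
all other points of the ω-limit set. -/
lemma fixed_dichotomy (h : FocusingOrbit Φ C x ψ κ τ r η t₀ N) {e : X} (he : e ∈ omegaSet Φ x)
    (hfix : ∀ s, ψ s e = e) :
    (∀ t, 0 ≤ t → Φ.toFun t x - e ∉ C) ∨ ∀ y ∈ omegaSet Φ x, y = e ∨ y - e ∈ interior C := by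
  refine or_iff_not_imp_left.2 fun hex y hy => ?_
  push Not at hex
  obtain ⟨t, ht, htC⟩ := hex
  refine h.psi_eq_or_mem_interior hy he one_pos ?_
  rw [hfix]
  obtain ⟨u, hu, hlim⟩ := exists_seq_tendsto_of_mem_omegaSet (h.psi_mem (-1) hy)
  refine h.closed.mem_of_tendsto (hlim.sub_const e) ?_
  filter_upwards [hu.eventually_ge_atTop t] with n hn
  have := h.mono.1 (u n - t) (by linarith) _ _ htC
  rwa [← Φ.map_add _ _ (by linarith) ht, sub_add_cancel, ← h.psi_eq (by linarith) he,
    hfix] at this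

lemma sub_notMem_of_orbit_sub_notMem (h : FocusingOrbit Φ C x ψ κ τ r η t₀ N) {e : X}
    (he : e ∈ omegaSet Φ x) (hfix : ∀ s, ψ s e = e)
    (hun : ∀ t, 0 ≤ t → Φ.toFun t x - e ∉ C) {y : X} (hy : y ∈ omegaSet Φ x) (hne : y ≠ e) :
    y - e ∉ C := by
  intro hC
  have hyC : ψ (-1) (ψ 1 y) - ψ (-1) e ∈ C := by rwa [h.psi_neg_psi _ hy, hfix]
  rcases h.psi_eq_or_mem_interior (h.psi_mem 1 hy) he one_pos hyC with h1 | h1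
  · apply hne
    rw [← h.psi_neg_psi 1 hy, h1, hfix]
  · obtain ⟨u, hu, hlim⟩ := exists_seq_tendsto_of_mem_omegaSet (h.psi_mem 1 hy)
    obtain ⟨n, hn, hn0⟩ := (((hlim.sub_const e).eventually (isOpen_interior.mem_nhds h1)).and
      (hu.eventually_ge_atTop 0)).exists
    exact hun _ hn0 (interior_subset hn)

end FocusingOrbit

end FocusingOrbit

/-- A telescoping bound with geometrically decaying blocks of increments. -/
lemma norm_sub_le_of_geometric_blocks {X : Type*} [NormedAddCommGroup X] {f : ℕ → X} {N J : ℕ}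
    {B μ : ℝ} (hμ : 0 < μ) (hμ1 : μ < 1) (hB : 0 ≤ B)
    (h : ∀ j < J, ∀ i < N, ‖f (j * N + i + 1) - f (j * N + i)‖ ≤ B * μ ^ (J - 1 - j)) :
    ‖f (J * N) - f 0‖ ≤ N * B * (1 - μ)⁻¹ := by
  have hblock : ∀ j < J, ‖f ((j + 1) * N) - f (j * N)‖ ≤ N * B * μ ^ (J - 1 - j) := by
    intro j hj
    have e := Finset.sum_range_sub (fun i => f (j * N + i)) N
    rw [add_zero] at e
    rw [add_mul, one_mul, ← e]
    refine (norm_sum_le _ _).trans ((Finset.sum_le_sum fun i hi =>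
      h j hj i (Finset.mem_range.1 hi)).trans ?_)
    simp [mul_assoc]
  have e := Finset.sum_range_sub (fun j => f (j * N)) J
  rw [zero_mul] at e
  rw [← e]
  calc ‖∑ j ∈ Finset.range J, (f ((j + 1) * N) - f (j * N))‖
      ≤ ∑ j ∈ Finset.range J, N * B * μ ^ (J - 1 - j) :=
        (norm_sum_le _ _).trans (Finset.sum_le_sum fun j hj => hblock j (Finset.mem_range.1 hj))
    _ = N * B * ∑ j ∈ Finset.range J, μ ^ j := by
        rw [← Finset.mul_sum, Finset.sum_range_reflect (fun m => μ ^ m)]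
    _ ≤ N * B * (1 - μ)⁻¹ :=
        mul_le_mul_of_nonneg_left ((Summable.sum_le_tsum _ (fun _ _ => by positivity)
          (summable_geometric_of_lt_one hμ.le hμ1)).trans_eq
            (tsum_geometric_of_lt_one hμ.le hμ1)) (by positivity)

namespace FocusingOrbit

variable {X : Type*} [NormedAddCommGroup X] [NormedSpace ℝ X]
  {Φ : Semiflow X} {C : Set X} {x : X} {ψ : ℝ → X → X} {κ τ r η t₀ : ℝ} {N : ℕ}

lemma exists_ball_map_subset (h : FocusingOrbit Φ C x ψ κ τ r η t₀ N) {e : X}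
    (he : e ∈ omegaSet Φ x) (hfix : ∀ s, ψ s e = e) :
    ∃ ρ > 0, ρ < r ∧ ∀ i : ℕ, i ≤ 2 * N → ∀ y ∈ ball e ρ, Φ.toFun (i * τ) y ∈ ball e r := by
  have hτ := h.τ_pos
  have h1 : ∀ᶠ y in nhds e, ∀ i ∈ Finset.range (2 * N + 1), Φ.toFun (i * τ) y ∈ ball e r := by
    refine (Filter.eventually_all_finset _).2 fun i _ => ?_
    have hi : 0 ≤ (i : ℝ) * τ := by positivity
    refine (Φ.continuous_toFun hi).continuousAt.eventually (isOpen_ball.mem_nhds ?_)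
    rw [← h.psi_eq hi he, hfix]
    exact mem_ball_self h.r_pos
  obtain ⟨ρ, hρ, hball⟩ := Metric.eventually_nhds_iff_ball.1 h1
  have := h.r_pos
  refine ⟨min ρ (r / 2), lt_min hρ (by linarith), (min_le_right _ _).trans_lt (by linarith),
    fun i hi y hy => hball y (ball_subset_ball (min_le_left _ _) hy) i ?_⟩
  exact Finset.mem_range.2 (by omega)

/-- An orbit accumulating at an unordered equilibrium leaves its neighbourhoods again and again,
after longer and longer stays. -/
lemma exists_exit (h : FocusingOrbit Φ C x ψ κ τ r η t₀ N) {e : X}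
    (he : e ∈ omegaSet Φ x) (hfix : ∀ s, ψ s e = e) (hun : ∀ t, 0 ≤ t → Φ.toFun t x - e ∉ C)
    {ρ : ℝ} (hρ : 0 < ρ)
    (hmap : ∀ i : ℕ, i ≤ 2 * N → ∀ y ∈ ball e ρ, Φ.toFun (i * τ) y ∈ ball e r) :
    ∃ (t : ℕ → ℝ) (J : ℕ → ℕ), (∀ n, t₀ < t n) ∧ Tendsto t atTop atTop ∧
      Tendsto (fun n => Φ.toFun (t n) x) atTop (nhds e) ∧
      (∀ n, ∀ j < J n, Φ.toFun (t n + j * (N * τ)) x ∈ ball e ρ) ∧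
      (∀ n, Φ.toFun (t n + J n * (N * τ)) x ∉ ball e ρ) ∧ Tendsto J atTop atTop := by
  classical
  have hτ := h.τ_pos
  have hθ0 := h.step_pos
  obtain ⟨u, hu, hlim⟩ := exists_seq_tendsto_of_mem_omegaSet he
  have hexit : ∀ t > t₀, ∃ j : ℕ, Φ.toFun (t + j * (N * τ)) x ∉ ball e ρ := by
    intro t ht
    by_contra hcon
    push Not at hcon
    have ht0 := h.t₀_nonneg.trans ht.le
    have hv := eq_zero_of_forall_pow_mul_le (by have := h.κ_pos; positivity) h.one_lt_factor
      (norm_nonneg _) fun J => (h.growth_orbit he hfix hun ht (J := J) fun j _ => by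
        have h0 := hmap 0 (by omega) _ (hcon j)
        have h1 := hmap 1 (by have := h.N_pos; omega) _ (hcon j)
        rw [← Φ.map_add _ _ (by positivity) (by positivity)] at h0 h1
        exact ⟨by simpa using h0, by simpa [add_comm] using h1⟩).2
    have hint := h.shift (t + N * τ) (by linarith)
    rw [norm_eq_zero, sub_eq_zero] at hv
    rw [hv, sub_self] at hint
    exact h.zero_notMem hint
  obtain ⟨n₀, hn₀⟩ := eventually_atTop.1 (hu.eventually_gt_atTop t₀)
  have hgt : ∀ n, t₀ < u (n + n₀) := fun n => hn₀ _ (by omega)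
  have htu : Tendsto (fun n => u (n + n₀)) atTop atTop := hu.comp (tendsto_add_atTop_nat n₀)
  have hlim' : Tendsto (fun n => Φ.toFun (u (n + n₀)) x) atTop (nhds e) :=
    hlim.comp (tendsto_add_atTop_nat n₀)
  refine ⟨fun n => u (n + n₀), fun n => Nat.find (hexit _ (hgt n)), hgt, htu, hlim',
    fun n j hj => by simpa using Nat.find_min _ hj, fun n => Nat.find_spec (hexit _ (hgt n)), ?_⟩
  refine tendsto_atTop.2 fun m => ?_
  have hev : ∀ᶠ n in atTop, ∀ j ∈ Finset.range m,
      Φ.toFun (u (n + n₀) + j * (N * τ)) x ∈ ball e ρ := by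
    refine (Filter.eventually_all_finset _).2 fun j _ => ?_
    have := h.tendsto_shift htu he hlim' (j * (N * τ))
    rw [hfix] at this
    exact this (ball_mem_nhds e hρ)
  filter_upwards [hev] with n hn
  rw [Nat.le_find_iff]
  exact fun j hj => not_not.2 (hn j (Finset.mem_range.2 hj))

/-- A point of the ω-limit set whose backward orbit stays close to an unordered equilibrium is an
equilibrium. -/
lemma psi_eq_self_of_backward_near (h : FocusingOrbit Φ C x ψ κ τ r η t₀ N) {e : X}
    (he : e ∈ omegaSet Φ x) (hfix : ∀ s, ψ s e = e) (hun : ∀ t, 0 ≤ t → Φ.toFun t x - e ∉ C)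
    {y : X} (hy : y ∈ omegaSet Φ x) (hne : y ≠ e)
    (hnear : ∀ j : ℕ, 1 ≤ j → dist (ψ (-(j * (N * τ))) y) e < r) (s : ℝ) : ψ s y = y := by
  set θ : ℝ := N * τ with hθ
  have hθ0 : 0 < θ := h.step_pos
  have hne' : ∀ s, ψ s y ≠ e := fun s hs => hne (by rw [← h.psi_neg_psi s hy, hs, hfix])
  have hnot : ∀ s, ψ s y - e ∉ C := fun s =>
    h.sub_notMem_of_orbit_sub_notMem he hfix hun (h.psi_mem s hy) (hne' s)
  set z : ℕ → X := fun J => ψ (-((J + 1 : ℕ) * θ)) y with hz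
  have hzω : ∀ J, z J ∈ omegaSet Φ x := fun J => h.psi_mem _ hy
  have hbound : ∀ s, 0 ≤ s → s ≤ η → ∀ J : ℕ,
      ‖ψ s (z J) - z J‖ ≤ r * (κ ^ 2 / 16)⁻¹ * ((1 + 3 * κ ^ 2 / 32)⁻¹) ^ J := by
    intro s hs hsη J
    have e1 : ∀ j : ℕ, ψ (j * θ) (z J) = ψ (-((J + 1 : ℕ) * θ) + j * θ) y := fun j => by
      rw [h.psi_psi _ _ hy, add_comm]
    have h1 := h.growth_psi (hzω J) he (s := s) (by rwa [abs_of_nonneg hs]) (J := J)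
      (fun j _ hC => by
        rw [hfix, sub_mem_cone_comm h.smul_mem, h.psi_psi _ _ hy] at hC
        exact hnot _ hC)
      (fun j hj => by
        rw [hfix, dist_comm, e1]
        have := hnear (J + 1 - j) (by omega)
        rw [Nat.cast_sub (by omega)] at this
        convert this using 3; ring)
      (fun hC => by
        rw [hfix, h.psi_psi _ _ hy] at hC
        exact hnot _ hC)
    have h2 : ‖e - z J‖ ≤ r := by
      rw [← dist_eq_norm, dist_comm]
      exact (hnear (J + 1) (by omega)).le
    have hκ := h.κ_pos
    have hΛ := h.one_lt_factor
    have hpos : 0 < κ ^ 2 / 16 * (1 + 3 * κ ^ 2 / 32) ^ J := by positivity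
    have h3 := (le_div_iff₀' hpos).2 (h1.trans h2)
    refine h3.trans (le_of_eq ?_)
    rw [inv_pow, div_eq_mul_inv, mul_inv, mul_assoc]
  set l : Ultrafilter ℕ := Ultrafilter.of atTop
  obtain ⟨e', he', hlim⟩ := h.exists_tendsto_of_mem l hzω
  have hfix' : ∀ s, ψ s e' = e' := h.psi_eq_self_of_forall_le he' h.η_pos fun s hs hsη => by
    have h1 : Tendsto (fun J => ψ s (z J) - z J) l (nhds (ψ s e' - e')) :=
      (h.tendsto_psi tendsto_const_nhds hlim (Eventually.of_forall hzω) he').sub hlim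
    have h2 : Tendsto (fun J => ψ s (z J) - z J) l (nhds 0) := by
      refine (squeeze_zero_norm (hbound s hs hsη) ?_).mono_left (Ultrafilter.of_le _)
      have hΛ := h.one_lt_factor
      have := (tendsto_pow_atTop_nhds_zero_of_lt_one (by positivity)
        (inv_lt_one_of_one_lt₀ hΛ)).const_mul (r * (κ ^ 2 / 16)⁻¹)
      rwa [mul_zero] at this
    exact sub_eq_zero.1 (tendsto_nhds_unique h1 h2)
  have hC : y - e' ∈ C := by
    refine h.closed.mem_of_tendsto (tendsto_const_nhds.sub hlim) (Eventually.of_forall fun J => ?_)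
    have := h.psi_sub_mem hy 0 (-((J + 1 : ℕ) * θ))
    rwa [h.psi_zero hy] at this
  have hne : e' ≠ e := by
    rintro rfl
    exact hnot 0 (by rwa [h.psi_zero hy])
  rcases h.fixed_dichotomy he' hfix' with h1 | h1
  · by_cases hye : y = e'
    · rw [hye, hfix']
    · exact absurd hC (h.sub_notMem_of_orbit_sub_notMem he' hfix' h1 hy hye)
  · rcases h1 e he with h2 | h2
    · exact absurd h2.symm hne
    · exact absurd ((sub_mem_cone_comm h.smul_mem).1 (interior_subset h2))
        (h.sub_notMem_of_orbit_sub_notMem he hfix hun he' hne)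

/-- Every equilibrium in the ω-limit set is strongly ordered with all its other points. -/
lemma eq_or_sub_mem_interior_of_fixed (h : FocusingOrbit Φ C x ψ κ τ r η t₀ N) {e : X}
    (he : e ∈ omegaSet Φ x) (hfix : ∀ s, ψ s e = e) {y : X} (hy : y ∈ omegaSet Φ x) :
    y = e ∨ y - e ∈ interior C := by
  refine (h.fixed_dichotomy he hfix).resolve_left (fun hun => ?_) y hy
  clear hy y
  obtain ⟨ρ, hρ, hρr, hmap⟩ := h.exists_ball_map_subset he hfix
  obtain ⟨t, J, ht₀, ht, hte, hin, hout, hJ⟩ := h.exists_exit he hfix hun hρ hmap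
  have hτ := h.τ_pos
  have hr := h.r_pos
  have hκ := h.κ_pos
  have hΛ := h.one_lt_factor
  set c : ℝ := κ ^ 2 / 16 with hc
  have hc0 : 0 < c := by positivity
  set Λ : ℝ := 1 + 3 * κ ^ 2 / 32
  have hθ0 : 0 < (N : ℝ) * τ := h.step_pos
  have ht0 : ∀ n, 0 ≤ t n := fun n => h.t₀_nonneg.trans (ht₀ n).le
  set l : Ultrafilter ℕ := Ultrafilter.of atTop
  have hl : (l : Filter ℕ) ≤ atTop := Ultrafilter.of_le _
  have hu : Tendsto (fun n => t n + J n * (N * τ)) l atTop :=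
    (tendsto_atTop_mono (fun n => le_add_of_nonneg_right (by positivity)) ht).mono_left hl
  obtain ⟨y, hy, hlim⟩ := h.exists_tendsto l hu
  have hye : ρ ≤ dist y e :=
    ge_of_tendsto' (hlim.dist tendsto_const_nhds) fun n => not_lt.1 (hout n)
  have hne : y ≠ e := by
    rintro rfl
    rw [dist_self] at hye
    linarith
  have hfixy : ∀ s, ψ s y = y := by
    refine h.psi_eq_self_of_backward_near he hfix hun hy hne fun j hj => ?_
    refine lt_of_le_of_lt ?_ hρr
    refine le_of_tendsto ((h.tendsto_shift hu hy hlim (-(j * (N * τ)))).dist tendsto_const_nhds) ?_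
    filter_upwards [hl (hJ.eventually_ge_atTop j)] with n hn
    have := hin n (J n - j) (by omega)
    rw [Nat.cast_sub hn] at this
    have e1 : t n + J n * (N * τ) + -(j * (N * τ)) = t n + (J n - j) * (N * τ) := by ring
    rw [e1]
    exact (mem_ball.1 this).le
  have hshift : ∀ s, Tendsto (fun n => Φ.toFun (t n + J n * (N * τ) + s) x) l (nhds y) :=
    fun s => by simpa [hfixy] using h.tendsto_shift hu hy hlim s
  have hK : ∀ ε > 0, ‖y - e‖ ≤ N * (2 * ε * r / (c * ρ)) * (1 - Λ⁻¹)⁻¹ := by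
    intro ε hε
    have hev : ∀ᶠ n in (l : Filter ℕ), ∀ i ∈ Finset.range N,
        ‖Φ.toFun (t n + J n * (N * τ) + (i * τ + τ)) x -
          Φ.toFun (t n + J n * (N * τ) + i * τ) x‖ ≤ ε ∧
        ρ / 2 ≤ ‖e - Φ.toFun (t n + J n * (N * τ) + i * τ) x‖ := by
      refine (Filter.eventually_all_finset _).2 fun i _ => ?_
      have h1 := ((hshift (i * τ + τ)).sub (hshift (i * τ))).norm
      rw [sub_self, norm_zero] at h1
      have h2 := ((hshift (i * τ)).const_sub e).norm
      rw [← dist_eq_norm, dist_comm] at h2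
      exact (h1.eventually_le_const hε).and (h2.eventually_const_le (by linarith))
    have hmain : ∀ᶠ n in (l : Filter ℕ),
        ‖Φ.toFun (t n + J n * (N * τ) + N * τ) x - Φ.toFun (t n + N * τ) x‖ ≤
          N * (2 * ε * r / (c * ρ)) * (1 - Λ⁻¹)⁻¹ := by
      filter_upwards [hev] with n hn
      have := norm_sub_le_of_geometric_blocks (f := fun m => Φ.toFun (t n + N * τ + m * τ) x)
        (N := N) (J := J n) (B := 2 * ε * r / (c * ρ)) (μ := Λ⁻¹) (by positivity)
        (inv_lt_one_of_one_lt₀ hΛ) (by positivity) fun j hj i hi => by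
          obtain ⟨hn1, hn2⟩ := hn i (Finset.mem_range.2 hi)
          have hpt : ∀ j' < J n, ∀ i' : ℕ, i' ≤ 2 * N →
              Φ.toFun (t n + j' * (N * τ) + i' * τ) x ∈ ball e r := by
            intro j' hj' i' hi'
            have := hmap i' hi' _ (hin n j' hj')
            rwa [← Φ.map_add _ _ (by positivity)
              (add_nonneg (ht0 n) (by positivity)), add_comm] at this
          have hgr := (h.growth_orbit he hfix hun (t := t n + i * τ + j * (N * τ))
            (lt_of_lt_of_le (ht₀ n) (by
              have : 0 ≤ (i : ℝ) * τ + j * (N * τ) := by positivity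
              linarith)) (J := J n - 1 - j) fun j' hj' => by
              have h1 := hpt (j + j') (by omega) i (by omega)
              have h2 := hpt (j + j') (by omega) (i + 1) (by omega)
              push_cast at h1 h2
              constructor
              · convert h1 using 2; ring
              · convert h2 using 2; ring).1
          have hr' : ‖e - Φ.toFun (t n + i * τ + j * (N * τ) + N * τ) x‖ ≤ r := by
            have := hpt j hj (N + i) (by omega)
            rw [mem_ball, dist_comm, dist_eq_norm] at this
            have e1 : t n + i * τ + j * (N * τ) + N * τ =
                t n + j * (N * τ) + ((N + i : ℕ) : ℝ) * τ := by push_cast; ring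
            rw [e1]
            exact this.le
          have e1 : t n + i * τ + j * (N * τ) + ((J n - 1 - j + 1 : ℕ) : ℝ) * (N * τ) =
              t n + J n * (N * τ) + i * τ := by
            have : J n - 1 - j + 1 = J n - j := by omega
            rw [this, Nat.cast_sub hj.le]; ring
          rw [e1, add_assoc (t n + J n * (N * τ))] at hgr
          have e2 : t n + N * τ + ((j * N + i + 1 : ℕ) : ℝ) * τ =
              t n + i * τ + j * (N * τ) + N * τ + τ := by push_cast; ring
          have e3 : t n + N * τ + ((j * N + i : ℕ) : ℝ) * τ =
              t n + i * τ + j * (N * τ) + N * τ := by push_cast; ring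
          rw [e2, e3]
          set v := ‖Φ.toFun (t n + i * τ + j * (N * τ) + N * τ + τ) x -
            Φ.toFun (t n + i * τ + j * (N * τ) + N * τ) x‖
          have hpow : 0 < Λ ^ (J n - 1 - j) := by positivity
          have hv : 0 ≤ c * Λ ^ (J n - 1 - j) * v := by positivity
          have h4 : c * Λ ^ (J n - 1 - j) * v * (ρ / 2) ≤ ε * r :=
            (mul_le_mul_of_nonneg_left hn2 hv).trans
              (hgr.trans (mul_le_mul hn1 hr' (norm_nonneg _) hε.le))
          rw [inv_pow, ← div_eq_mul_inv, div_div, le_div_iff₀ (by positivity)]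
          linarith
      have e4 : t n + N * τ + ((J n * N : ℕ) : ℝ) * τ = t n + J n * (N * τ) + N * τ := by
        push_cast; ring
      simpa only [e4, Nat.cast_zero, zero_mul, add_zero] using this
    have h5 : Tendsto (fun n => Φ.toFun (t n + N * τ) x) l (nhds e) := by
      simpa [hfix] using (h.tendsto_shift ht he hte (N * τ)).mono_left hl
    exact le_of_tendsto ((hshift (N * τ)).sub h5).norm hmain
  have hlim0 : Tendsto (fun ε : ℝ => N * (2 * ε * r / (c * ρ)) * (1 - Λ⁻¹)⁻¹)
      (nhdsWithin 0 (Ioi 0)) (nhds 0) := by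
    have : Tendsto (fun ε : ℝ => N * (2 * ε * r / (c * ρ)) * (1 - Λ⁻¹)⁻¹) (nhds 0)
        (nhds (N * (2 * 0 * r / (c * ρ)) * (1 - Λ⁻¹)⁻¹)) := by
      apply Continuous.tendsto
      fun_prop
    simpa using this.mono_left nhdsWithin_le_nhds
  have hle : ‖y - e‖ ≤ 0 := ge_of_tendsto hlim0 (by
    filter_upwards [self_mem_nhdsWithin] with ε hε
    exact hK ε hε)
  exact hne (sub_eq_zero.1 (norm_le_zero_iff.1 hle))

end FocusingOrbit

/-- Short forward time shifts of `ψ t z` are never strongly ordered with `ψ t w`. -/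
def ShiftUnordered {X : Type*} [NormedAddCommGroup X] (C : Set X) (ψ : ℝ → X → X) (σ : ℝ)
    (z w : X) : Prop :=
  ∀ t, 0 ≤ t → ∀ s, 0 ≤ s → s ≤ σ → ψ (t + s) z - ψ t w ∉ interior C

namespace FocusingOrbit

variable {X : Type*} [NormedAddCommGroup X] [NormedSpace ℝ X]
  {Φ : Semiflow X} {C : Set X} {x : X} {ψ : ℝ → X → X} {κ τ r η t₀ : ℝ} {N : ℕ}

/-- Distinct points of an orbit in the ω-limit set are strongly ordered. -/
lemma psi_eq_or_sub_mem_interior (h : FocusingOrbit Φ C x ψ κ τ r η t₀ N) {z : X}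
    (hz : z ∈ omegaSet Φ x) (s t : ℝ) : ψ s z = ψ t z ∨ ψ s z - ψ t z ∈ interior C := by
  refine h.psi_eq_or_mem_interior (h.psi_mem s hz) (h.psi_mem t hz) one_pos ?_
  rw [h.psi_psi _ _ hz, h.psi_psi _ _ hz]
  exact h.psi_sub_mem hz _ _

lemma sub_notMem_of_shiftUnordered (h : FocusingOrbit Φ C x ψ κ τ r η t₀ N) {σ : ℝ}
    (hσ : 0 < σ) {z w : X} (hz : z ∈ omegaSet Φ x) (hw : w ∈ omegaSet Φ x)
    (hzw : ShiftUnordered C ψ σ z w) (hne : ¬ ∀ s, ψ s z = z) {t s : ℝ} (ht : 0 ≤ t)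
    (hs : 0 ≤ s) (hsσ : s ≤ σ) : ψ (t + s) z - ψ t w ∉ C := by
  intro hC
  by_cases heq : ψ (t + s) z = ψ t w
  · have h1 : ∀ s', 0 ≤ s' → s' ≤ σ → ψ (t + s') z = ψ (t + s) z := fun s' hs' hsσ' =>
      (h.psi_eq_or_sub_mem_interior hz _ _).resolve_right fun h2 =>
        hzw t ht s' hs' hsσ' (heq ▸ h2)
    refine hne (h.psi_eq_self_of_psi hz (t := t)
      (h.psi_eq_self_of_forall_le (h.psi_mem t hz) hσ fun s' hs' hsσ' => ?_))
    have h2 := h1 0 le_rfl hσ.le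
    rw [add_zero] at h2
    rw [h.psi_psi _ _ hz, add_comm, h1 s' hs' hsσ', h2]
  · have h1 := h.mono.2 1 one_pos _ _ hC heq
    rw [← h.psi_eq zero_le_one (h.psi_mem _ hz), ← h.psi_eq zero_le_one (h.psi_mem _ hw),
      h.psi_psi _ _ hz, h.psi_psi _ _ hw, ← add_assoc] at h1
    exact hzw (1 + t) (by linarith) s hs hsσ h1

/-- The first member of a shift-unordered pair of nearby forward orbits is an equilibrium. -/
lemma psi_eq_self_of_shiftUnordered (h : FocusingOrbit Φ C x ψ κ τ r η t₀ N) {σ : ℝ}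
    (hσ : 0 < σ) {z w : X} (hz : z ∈ omegaSet Φ x) (hw : w ∈ omegaSet Φ x)
    (hzw : ShiftUnordered C ψ σ z w) (hd : ∀ t, 0 ≤ t → dist (ψ t w) (ψ t z) < r) (s : ℝ) :
    ψ s z = z := by
  revert s
  by_contra hne
  refine hne (h.psi_eq_self_of_forall_le hz (lt_min hσ h.η_pos) fun s hs hsσ => ?_)
  have hθ := h.step_pos
  have hun := fun {t s : ℝ} => h.sub_notMem_of_shiftUnordered hσ hz hw hzw hne (t := t) (s := s)
  refine sub_eq_zero.1 (norm_eq_zero.1 (eq_zero_of_forall_pow_mul_le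
    (c := κ ^ 2 / 16) (B := ‖w - z‖) ?_ h.one_lt_factor (norm_nonneg _) fun J =>
    h.growth_psi hz hw ?_ ?_ ?_ ?_))
  · have := h.κ_pos; positivity
  · rw [abs_of_nonneg hs]; exact hsσ.trans (min_le_right _ _)
  · intro j _
    rw [sub_mem_cone_comm h.smul_mem]
    have := hun (t := j * (N * τ)) (s := 0) (by positivity) le_rfl hσ.le
    rwa [add_zero] at this
  · exact fun j _ => hd _ (by positivity)
  · exact hun (by positivity) hs (hsσ.trans (min_le_left _ _))

/-- Return times of orbits in a minimal set to a neighbourhood of a given point are bounded. -/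
lemma exists_forall_return (h : MonotoneOrbit Φ C x ψ) {M : Set X} (hMω : M ⊆ omegaSet Φ x)
    (hMc : IsClosed M) (hMi : ∀ t, 0 ≤ t → ∀ z ∈ M, ψ t z ∈ M)
    (hmin : ∀ A ⊆ M, IsClosed A → A.Nonempty → (∀ t, 0 ≤ t → ∀ z ∈ A, ψ t z ∈ A) → A = M)
    {m : X} (hm : m ∈ M) {ε : ℝ} (hε : 0 < ε) :
    ∃ S : ℝ, ∀ b ∈ M, ∃ s, 1 ≤ s ∧ s ≤ S ∧ ψ s b ∈ ball m ε := by
  have hcont : ∀ s : ℝ, ContinuousOn (ψ s) (omegaSet Φ x) := fun s z hz =>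
    h.tendsto_psi tendsto_const_nhds (tendsto_id.mono_left nhdsWithin_le_nhds)
      eventually_mem_nhdsWithin hz
  have hret : ∀ b ∈ M, ∃ s, 1 ≤ s ∧ ψ s b ∈ ball m ε := by
    set A : Set X := {b | b ∈ M ∧ ∀ s, 0 ≤ s → ψ s b ∉ ball m ε} with hA
    have hAc : IsClosed A := by
      have : A = M ∩ ⋂ s ∈ Ici (0 : ℝ), (M ∩ ψ s ⁻¹' (ball m ε)ᶜ) := by
        ext b; simp only [hA, mem_ofPred_eq, mem_inter_iff, mem_iInter, mem_Ici, mem_preimage,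
          mem_compl_iff]
        exact ⟨fun hb => ⟨hb.1, fun s hs => ⟨hb.1, hb.2 s hs⟩⟩,
          fun hb => ⟨hb.1, fun s hs => (hb.2 s hs).2⟩⟩
      rw [this]
      exact hMc.inter (isClosed_biInter fun s _ =>
        ((hcont s).mono hMω).preimage_isClosed_of_isClosed hMc isOpen_ball.isClosed_compl)
    intro b hb
    by_contra! hno
    have hbA : ψ 1 b ∈ A := ⟨hMi 1 zero_le_one b hb, fun s hs => by
      rw [h.psi_psi _ _ (hMω hb)]; exact hno _ (by linarith)⟩
    have := hmin A (fun _ hz => hz.1) hAc ⟨_, hbA⟩ fun t ht z hz =>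
      ⟨hMi t ht z hz.1, fun s hs => by
        rw [h.psi_psi _ _ (hMω hz.1)]; exact hz.2 _ (by linarith)⟩
    have hmA : m ∈ A := this ▸ hm
    exact hmA.2 0 le_rfl (by rw [h.psi_zero (hMω hm)]; exact mem_ball_self hε)
  by_contra! hno
  choose b hbM hb using fun n : ℕ => hno n
  set l := Ultrafilter.of (atTop : Filter ℕ)
  have hl : (l : Filter ℕ) ≤ atTop := Ultrafilter.of_le _
  obtain ⟨z, hz, hlim⟩ := h.exists_tendsto_of_mem l (fun n => hMω (hbM n))
  have hzM : z ∈ M := hMc.mem_of_tendsto hlim (Eventually.of_forall hbM)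
  obtain ⟨s, hs, hsz⟩ := hret z hzM
  have h1 := h.tendsto_psi (tendsto_const_nhds (x := s)) hlim
    (Eventually.of_forall fun n => hMω (hbM n)) hz
  obtain ⟨n, hn1, hn2⟩ := ((h1.eventually (isOpen_ball.mem_nhds hsz)).and
    ((tendsto_natCast_atTop_atTop.eventually_ge_atTop s).filter_mono hl)).exists
  exact hb n s hs hn2 hn1

/-- A non-equilibrium in a minimal set is ordered with the whole ω-limit set. -/
lemma sub_mem_of_minimal (h : FocusingOrbit Φ C x ψ κ τ r η t₀ N) {M : Set X}
    (hMω : M ⊆ omegaSet Φ x) (hMc : IsClosed M) (hMi : ∀ t, 0 ≤ t → ∀ z ∈ M, ψ t z ∈ M)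
    (hmin : ∀ A ⊆ M, IsClosed A → A.Nonempty → (∀ t, 0 ≤ t → ∀ z ∈ A, ψ t z ∈ A) → A = M)
    {m : X} (hm : m ∈ M) (hne : ¬ ∀ s, ψ s m = m) {y : X} (hy : y ∈ omegaSet Φ x) :
    y - m ∈ C := by
  by_contra hym
  obtain ⟨ε, hε, hball⟩ : ∃ ε > 0, ∀ y' ∈ ball y ε, ∀ m' ∈ ball m ε, y' - m' ∉ C := by
    have h1 : ∀ᶠ p : X × X in nhds (y, m), p.1 - p.2 ∉ C :=
      (h.closed.isOpen_compl.preimage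
        (continuous_fst.sub continuous_snd)).mem_nhds (x := (y, m)) hym
    obtain ⟨ε, hε, h2⟩ := Metric.eventually_nhds_iff_ball.1 h1
    exact ⟨ε, hε, fun y' hy' m' hm' => h2 (y', m')
      (by rw [← ball_prod_same]; exact ⟨hy', hm'⟩)⟩
  have hmω := hMω hm
  obtain ⟨l, hl, hsmall⟩ := h.exists_small (half_pos hε)
  obtain ⟨S, hS⟩ := exists_forall_return h.toMonotoneOrbit hMω hMc hMi hmin hm (half_pos hε)
  have hmove : ∀ s, ∃ e, 0 ≤ e ∧ e ≤ l ∧ m - ψ (s + e) m ∈ interior C := by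
    intro s
    by_contra! hno
    have h1 : ∀ e, 0 ≤ e → e ≤ l → ψ (s + e) m = m := fun e he hel => by
      have := h.psi_eq_or_sub_mem_interior hmω 0 (s + e)
      rw [h.psi_zero hmω] at this
      exact (this.resolve_right (hno e he hel)).symm
    have h2 : ψ s m = m := by simpa using h1 0 le_rfl hl.le
    refine hne (h.psi_eq_self_of_forall_le hmω hl fun e he hel => ?_)
    have := h1 e he hel
    rwa [add_comm, ← h.psi_psi _ _ hmω, h2] at this
  have hnear : ∀ᶠ v in nhds m, ∀ s ∈ Icc 1 S, ∃ e, 0 ≤ e ∧ e ≤ l ∧ v - ψ (s + e) m ∈ C := by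
    refine isCompact_Icc.eventually_forall_of_forall_eventually fun s _ => ?_
    obtain ⟨e, he, hel, hC⟩ := hmove s
    have hcont : Continuous fun p : X × ℝ => p.1 - ψ (p.2 + e) m :=
      continuous_fst.sub ((h.continuous_psi hmω).comp (continuous_snd.add continuous_const))
    exact (hcont.continuousAt.eventually (isOpen_interior.mem_nhds hC)).mono
      fun p hp => ⟨e, he, hel, interior_subset hp⟩
  obtain ⟨u, hu, hum⟩ := exists_seq_tendsto_of_mem_omegaSet hmω
  obtain ⟨n, hn, hn0⟩ := ((hum.eventually hnear).and (hu.eventually_ge_atTop 0)).exists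
  obtain ⟨v, hv, hvy⟩ := exists_seq_tendsto_of_mem_omegaSet hy
  obtain ⟨k, hk, hk0⟩ := ((hvy.eventually (isOpen_ball.mem_nhds (mem_ball_self hε))).and
    (hv.eventually_ge_atTop (u n))).exists
  have hρ : 0 ≤ v k - u n := by linarith
  obtain ⟨s, hs1, hsS, hs⟩ := hS _ (hMi _ hρ m hm)
  obtain ⟨e, he, hel, hC⟩ := hn s ⟨hs1, hsS⟩
  have h1 := h.mono.1 _ hρ _ _ hC
  rw [← Φ.map_add _ _ hρ hn0, sub_add_cancel, ← h.psi_eq hρ (h.psi_mem _ hmω),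
    h.psi_psi _ _ hmω] at h1
  refine hball _ hk _ ?_ h1
  rw [h.psi_psi _ _ hmω] at hs
  have h2 := hsmall _ (h.psi_mem (s + (v k - u n)) hmω) e (by rwa [abs_of_nonneg he])
  rw [h.psi_psi _ _ hmω] at h2
  rw [show v k - u n + (s + e) = e + (s + (v k - u n)) by ring]
  rw [mem_ball] at hs ⊢
  linarith [dist_triangle (ψ (e + (s + (v k - u n))) m) (ψ (s + (v k - u n)) m) m]

end FocusingOrbit

/-- Every nonempty closed forward invariant subset of the ω-limit set contains a minimal one. -/
lemma MonotoneOrbit.exists_minimal {X : Type*} [NormedAddCommGroup X] [NormedSpace ℝ X]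
    {Φ : Semiflow X} {C : Set X} {x : X} {ψ : ℝ → X → X} (h : MonotoneOrbit Φ C x ψ) {A : Set X}
    (hAω : A ⊆ omegaSet Φ x) (hAc : IsClosed A) (hA0 : A.Nonempty)
    (hAi : ∀ t, 0 ≤ t → ∀ z ∈ A, ψ t z ∈ A) :
    ∃ M ⊆ A, IsClosed M ∧ M.Nonempty ∧ (∀ t, 0 ≤ t → ∀ z ∈ M, ψ t z ∈ M) ∧
      ∀ B ⊆ M, IsClosed B → B.Nonempty → (∀ t, 0 ≤ t → ∀ z ∈ B, ψ t z ∈ B) → B = M := by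
  set F : Set (Set X) := {B | IsClosed B ∧ B.Nonempty ∧ ∀ t, 0 ≤ t → ∀ z ∈ B, ψ t z ∈ B} with hF
  obtain ⟨M, hMA, hM⟩ := zorn_superset_nonempty {B | B ⊆ A ∧ B ∈ F} (fun c hc hchain hc0 => by
    refine ⟨⋂₀ c, ⟨?_, isClosed_sInter fun B hB => (hc hB).2.1, ?_, ?_⟩,
      fun B hB => sInter_subset_of_mem hB⟩
    · obtain ⟨B, hB⟩ := hc0
      exact (sInter_subset_of_mem hB).trans (hc hB).1
    · have : Nonempty c := hc0.to_subtype
      refine IsCompact.nonempty_sInter_of_directed_nonempty_isCompact_isClosed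
        (fun B hB D hD => ?_) (fun B hB => (hc hB).2.2.1)
        (fun B hB => ?_) fun B hB => (hc hB).2.1
      · rcases hchain.total hB hD with hBD | hDB
        · exact ⟨B, hB, Subset.rfl, hBD⟩
        · exact ⟨D, hD, hDB, Subset.rfl⟩
      · exact h.isCompact_omegaSet.of_isClosed_subset (hc hB).2.1 ((hc hB).1.trans hAω)
    · exact fun t ht z hz B hB => (hc hB).2.2.2 t ht z (hz B hB)) A ⟨Subset.rfl, hAc, hA0, hAi⟩
  exact ⟨M, hMA, hM.prop.2.1, hM.prop.2.2.1, hM.prop.2.2.2, fun B hB hBc hB0 hBi =>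
    hB.antisymm (hM.le_of_le ⟨hB.trans hMA, hBc, hB0, hBi⟩ hB)⟩

namespace FocusingOrbit

variable {X : Type*} [NormedAddCommGroup X] [NormedSpace ℝ X]
  {Φ : Semiflow X} {C : Set X} {x : X} {ψ : ℝ → X → X} {κ τ r η t₀ : ℝ} {N : ℕ}

/-- Limits of an orbit pair that is never strongly ordered are shift-unordered. -/
lemma shiftUnordered_of_tendsto (h : MonotoneOrbit Φ C x ψ) {σ : ℝ}
    {a : X} (ha : a ∈ omegaSet Φ x)
    (hxa : ∀ ρ, 0 ≤ ρ → ∀ s, 0 ≤ s → s ≤ σ → Φ.toFun (ρ + s) x - ψ ρ a ∉ interior C)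
    {ι : Type*} {l : Filter ι} [l.NeBot] {u : ι → ℝ} (hu : Tendsto u l atTop) {z w : X}
    (hz : z ∈ omegaSet Φ x) (hw : w ∈ omegaSet Φ x)
    (hzl : Tendsto (fun i => Φ.toFun (u i) x) l (nhds z))
    (hwl : Tendsto (fun i => ψ (u i) a) l (nhds w)) : ShiftUnordered C ψ σ z w := by
  intro t ht s hs hsσ
  have h1 := (h.tendsto_shift hu hz hzl (t + s)).sub (h.tendsto_psi
    (tendsto_const_nhds (x := t)) hwl (Eventually.of_forall fun i => h.psi_mem _ ha) hw)
  refine isOpen_interior.isClosed_compl.mem_of_tendsto h1 ?_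
  filter_upwards [hu.eventually_ge_atTop 0] with i hi
  have := hxa (u i + t) (by linarith) s hs hsσ
  rwa [h.psi_psi _ _ ha, add_comm t (u i), ← add_assoc]

/-- Limit of an orbit pair whose members stay close together. -/
lemma psi_eq_self_of_tendsto (h : FocusingOrbit Φ C x ψ κ τ r η t₀ N) {σ : ℝ} (hσ : 0 < σ)
    {a : X} (ha : a ∈ omegaSet Φ x)
    (hxa : ∀ ρ, 0 ≤ ρ → ∀ s, 0 ≤ s → s ≤ σ → Φ.toFun (ρ + s) x - ψ ρ a ∉ interior C)
    {ι : Type*} {l : Filter ι} [l.NeBot] {u : ι → ℝ} (hu : Tendsto u l atTop) {z w : X}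
    (hz : z ∈ omegaSet Φ x) (hw : w ∈ omegaSet Φ x)
    (hzl : Tendsto (fun i => Φ.toFun (u i) x) l (nhds z))
    (hwl : Tendsto (fun i => ψ (u i) a) l (nhds w))
    (hd : ∀ t, 0 < t → ∀ᶠ i in l, dist (Φ.toFun (u i + t) x) (ψ (u i + t) a) ≤ r / 2) (s : ℝ) :
    ψ s z = z := by
  have hpos : ∀ t, 0 < t → dist (ψ t w) (ψ t z) ≤ r / 2 := by
    intro t ht
    have h1 := (h.tendsto_psi (tendsto_const_nhds (x := t)) hwl
      (Eventually.of_forall fun i => h.psi_mem _ ha) hw).dist (h.tendsto_shift hu hz hzl t)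
    refine le_of_tendsto h1 ((hd t ht).mono fun i hi => ?_)
    rwa [h.psi_psi _ _ ha, add_comm t, dist_comm]
  refine h.psi_eq_self_of_shiftUnordered hσ hz hw
    (shiftUnordered_of_tendsto h.toMonotoneOrbit ha hxa hu hz hw hzl hwl) (fun t ht => ?_) s
  have h2 : Continuous fun t => dist (ψ t w) (ψ t z) :=
    (h.continuous_psi hw).dist (h.continuous_psi hz)
  have h3 : dist (ψ t w) (ψ t z) ≤ r / 2 :=
    le_of_tendsto ((h2.tendsto t).mono_left (nhdsWithin_le_nhds (s := Ioi t)))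
      (eventually_mem_nhdsWithin.mono fun s hs => hpos s (ht.trans_lt hs))
  linarith [h.r_pos]

/-- Some equilibrium is a common limit of both members of an orbit pair that is never strongly
ordered. -/
lemma exists_fixed_tendsto (h : FocusingOrbit Φ C x ψ κ τ r η t₀ N) {σ : ℝ} (hσ : 0 < σ)
    {a : X} (ha : a ∈ omegaSet Φ x)
    (hxa : ∀ ρ, 0 ≤ ρ → ∀ s, 0 ≤ s → s ≤ σ → Φ.toFun (ρ + s) x - ψ ρ a ∉ interior C) :
    ∃ e ∈ omegaSet Φ x, (∀ s, ψ s e = e) ∧ ∃ l : Ultrafilter ℝ, (l : Filter ℝ) ≤ atTop ∧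
      Tendsto (fun ρ => Φ.toFun ρ x) l (nhds e) ∧ Tendsto (fun ρ => ψ ρ a) l (nhds e) := by
  set A : Set X := {z | MapClusterPt z atTop fun ρ => ψ ρ a} with hA
  have hωc := h.isCompact_omegaSet.isClosed
  have hAω : A ⊆ omegaSet Φ x := by
    intro z hz
    obtain ⟨l, -, hl⟩ := mapClusterPt_iff_ultrafilter.1 hz
    exact hωc.mem_of_tendsto hl (Eventually.of_forall fun ρ => h.psi_mem ρ ha)
  have hA0 : A.Nonempty := by
    obtain ⟨z, -, hz⟩ := h.exists_tendsto_of_mem (Ultrafilter.of (atTop : Filter ℝ))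
      (fun ρ => h.psi_mem ρ ha)
    exact ⟨z, mapClusterPt_iff_ultrafilter.2 ⟨_, Ultrafilter.of_le _, hz⟩⟩
  have hAi : ∀ t, 0 ≤ t → ∀ z ∈ A, ψ t z ∈ A := by
    intro t _ z hz
    obtain ⟨l, hl, hlz⟩ := mapClusterPt_iff_ultrafilter.1 hz
    have h1 := h.tendsto_psi (tendsto_const_nhds (x := t)) hlz
      (Eventually.of_forall fun ρ => h.psi_mem ρ ha) (hAω hz)
    simp only [h.psi_psi _ _ ha] at h1
    refine mapClusterPt_iff_ultrafilter.2 ⟨l.map (t + ·), ?_, ?_⟩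
    · exact tendsto_atTop_add_const_left _ t (tendsto_id.mono_left hl)
    · rw [Ultrafilter.coe_map, tendsto_map'_iff]
      exact h1
  obtain ⟨M, hMA, hMc, ⟨m, hm⟩, hMi, hmin⟩ :=
    h.exists_minimal hAω isClosed_setOfPred_clusterPt hA0 hAi
  have hMω := hMA.trans hAω
  have hmω := hMω hm
  obtain ⟨l, hl, hlm⟩ := mapClusterPt_iff_ultrafilter.1 (hMA hm)
  obtain ⟨y, hy, hly⟩ := h.exists_tendsto l (u := id) (tendsto_id.mono_left hl)
  have hpair := shiftUnordered_of_tendsto h.toMonotoneOrbit ha hxa (u := id)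
    (tendsto_id.mono_left hl) hy hmω hly hlm
  have hfix : ∀ s, ψ s m = m := by
    by_contra hne
    have h1 : ∀ s, 0 ≤ s → s ≤ σ → ψ (1 + s) y = ψ 1 m := by
      intro s hs hsσ
      refine (h.psi_eq_or_mem_interior (h.psi_mem _ hy) (h.psi_mem _ hmω) one_pos
        ?_).resolve_right (hpair 1 zero_le_one s hs hsσ)
      rw [h.psi_neg_psi 1 hmω]
      exact h.sub_mem_of_minimal hMω hMc hMi hmin hm hne (h.psi_mem _ (h.psi_mem _ hy))
    have h2 : ψ 1 y = ψ 1 m := by simpa using h1 0 le_rfl hσ.le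
    refine hne (h.psi_eq_self_of_psi hmω (t := 1)
      (h.psi_eq_self_of_forall_le (h.psi_mem _ hmω) hσ fun s hs hsσ => ?_))
    rw [← h2, h.psi_psi _ _ hy, add_comm, h1 s hs hsσ, h2]
  have hye : y = m := by
    refine (h.eq_or_sub_mem_interior_of_fixed hmω hfix hy).resolve_right ?_
    have := hpair 0 le_rfl 0 le_rfl hσ.le
    rwa [add_zero, h.psi_zero hy, h.psi_zero hmω] at this
  exact ⟨m, hmω, hfix, l, hl, hye ▸ hly, hlm⟩

/-- If an orbit pair that is never strongly ordered separates at arbitrarily large times, then it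
also does so followed by arbitrarily long periods of closeness. -/
lemma exists_last_separation (h : FocusingOrbit Φ C x ψ κ τ r η t₀ N) {σ : ℝ} (hσ : 0 < σ)
    {a : X} (ha : a ∈ omegaSet Φ x)
    (hxa : ∀ ρ, 0 ≤ ρ → ∀ s, 0 ≤ s → s ≤ σ → Φ.toFun (ρ + s) x - ψ ρ a ∉ interior C)
    {n : ℝ} (hn : 0 ≤ n) {v : ℝ} (hnv : n ≤ v) (hv : r / 2 ≤ dist (Φ.toFun v x) (ψ v a)) :
    ∃ T, n ≤ T ∧ r / 2 ≤ dist (Φ.toFun T x) (ψ T a) ∧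
      ∀ t, 0 < t → t ≤ n → dist (Φ.toFun (T + t) x) (ψ (T + t) a) ≤ r / 2 := by
  obtain ⟨e, he, hfix, l, hl, hxl, hal⟩ := h.exists_fixed_tendsto hσ ha hxa
  obtain ⟨ρ, hvρ, hρ⟩ : ∃ ρ, v ≤ ρ ∧ ∀ t, 0 ≤ t → t ≤ n →
      dist (Φ.toFun (ρ + t) x) (ψ (ρ + t) a) < r / 2 := by
    by_contra! hno
    have hno' : ∀ ρ : ℝ, ∃ t ∈ Icc 0 n, v ≤ ρ →
        r / 2 ≤ dist (Φ.toFun (ρ + t) x) (ψ (ρ + t) a) := by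
      intro ρ
      by_cases hρ : v ≤ ρ
      · obtain ⟨t, h1, h2, h3⟩ := hno ρ hρ
        exact ⟨t, ⟨h1, h2⟩, fun _ => h3⟩
      · exact ⟨0, ⟨le_rfl, hn⟩, fun hρ' => absurd hρ' hρ⟩
    choose t ht hdt using hno'
    obtain ⟨t', ht', htl⟩ := isCompact_Icc.ultrafilter_le_nhds (l.map t) (by
      rw [le_principal_iff]
      exact Eventually.of_forall (f := (l : Filter ℝ)) ht)
    have h1 := Φ.tendsto_toFun ht'.1 htl (Eventually.of_forall fun ρ => (ht ρ).1) hxl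
    have h2 := h.tendsto_psi htl hal (Eventually.of_forall fun ρ => h.psi_mem ρ ha) he
    rw [← h.psi_eq ht'.1 he] at h1
    have h3 := h1.dist h2
    rw [dist_self] at h3
    refine absurd (ge_of_tendsto (b := r / 2) h3 ?_) (not_le.2 (half_pos h.r_pos))
    filter_upwards [hl (eventually_ge_atTop v)] with ρ hρ
    have hρ : v ≤ ρ := hρ
    have := hdt ρ hρ
    rwa [add_comm ρ, Φ.map_add _ _ (ht ρ).1 (by linarith), ← h.psi_psi _ _ ha] at this
  have hcont : ContinuousOn (fun t => dist (Φ.toFun t x) (ψ t a)) (Icc v ρ) := by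
    intro t ht
    refine Tendsto.dist ?_ (h.continuous_psi ha).continuousWithinAt
    exact Φ.tendsto_toFun (by linarith [ht.1]) (tendsto_id.mono_left nhdsWithin_le_nhds)
      (eventually_mem_nhdsWithin.mono fun s hs => by
        have : v ≤ s := hs.1
        change 0 ≤ s; linarith) tendsto_const_nhds
  obtain ⟨T, ⟨hTI, hTd⟩, hTmax⟩ := (isCompact_Icc.of_isClosed_subset
    (hcont.preimage_isClosed_of_isClosed isClosed_Icc (isClosed_Ici (a := r / 2)))
    inter_subset_left).exists_isGreatest ⟨v, ⟨le_rfl, hvρ⟩, hv⟩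
  refine ⟨T, hnv.trans hTI.1, hTd, fun t ht htn => ?_⟩
  rcases le_total ρ (T + t) with hle | hle
  · have := hρ (T + t - ρ) (by linarith) (by linarith [hTI.2])
    rw [add_sub_cancel] at this
    exact this.le
  · by_contra! hlt
    have := hTmax ⟨⟨by linarith [hTI.1], hle⟩, mem_Ici.2 hlt.le⟩
    linarith

/-- If the orbit of `a` is never strongly ordered with that of `x`, then the ω-limit set consists
of equilibria. -/
lemma psi_eq_self_of_orbit (h : FocusingOrbit Φ C x ψ κ τ r η t₀ N) {σ : ℝ} (hσ : 0 < σ)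
    {a : X} (ha : a ∈ omegaSet Φ x)
    (hxa : ∀ ρ, 0 ≤ ρ → ∀ s, 0 ≤ s → s ≤ σ → Φ.toFun (ρ + s) x - ψ ρ a ∉ interior C)
    {p : X} (hp : p ∈ omegaSet Φ x) (s : ℝ) : ψ s p = p := by
  set l := Ultrafilter.of (atTop : Filter ℕ)
  have hl : (l : Filter ℕ) ≤ atTop := Ultrafilter.of_le _
  by_cases hcase : ∃ R : ℝ, ∀ ρ, R ≤ ρ → dist (Φ.toFun ρ x) (ψ ρ a) ≤ r / 2
  · obtain ⟨R, hR⟩ := hcase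
    obtain ⟨u, hu, hup⟩ := exists_seq_tendsto_of_mem_omegaSet hp
    obtain ⟨w, hw, hwl⟩ := h.exists_tendsto_of_mem l (fun n => h.psi_mem (u n) ha)
    refine h.psi_eq_self_of_tendsto hσ ha hxa (hu.mono_left hl) hp hw (hup.mono_left hl) hwl
      (fun t ht => ?_) s
    filter_upwards [(hu.mono_left hl).eventually_ge_atTop R] with n hn
    exact hR _ (by linarith)
  · exfalso
    push Not at hcase
    have hsep : ∀ n : ℕ, ∃ T : ℝ, (n : ℝ) ≤ T ∧ r / 2 ≤ dist (Φ.toFun T x) (ψ T a) ∧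
        ∀ t : ℝ, 0 < t → t ≤ n → dist (Φ.toFun (T + t) x) (ψ (T + t) a) ≤ r / 2 := by
      intro n
      obtain ⟨v, hnv, hv⟩ := hcase n
      exact h.exists_last_separation hσ ha hxa (Nat.cast_nonneg n) hnv hv.le
    choose T hT hTd hTt using hsep
    have hTl : Tendsto T l atTop :=
      (tendsto_atTop_mono hT tendsto_natCast_atTop_atTop).mono_left hl
    obtain ⟨z, hz, hzl⟩ := h.exists_tendsto l hTl
    obtain ⟨w, hw, hwl⟩ := h.exists_tendsto_of_mem l (fun n => h.psi_mem (T n) ha)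
    have hfix := h.psi_eq_self_of_tendsto hσ ha hxa hTl hz hw hzl hwl fun t ht => by
      filter_upwards [(tendsto_natCast_atTop_atTop.mono_left hl).eventually_ge_atTop t] with n hn
      exact hTt n t ht hn
    have hdist : r / 2 ≤ dist z w := ge_of_tendsto' (hzl.dist hwl) hTd
    have hpair := shiftUnordered_of_tendsto h.toMonotoneOrbit ha hxa hTl hz hw hzl hwl
      0 le_rfl 0 le_rfl hσ.le
    rw [add_zero, h.psi_zero hz, h.psi_zero hw] at hpair
    rcases h.eq_or_sub_mem_interior_of_fixed hz hfix hw with rfl | hC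
    · rw [dist_self] at hdist
      linarith [h.r_pos]
    · exact hpair ((sub_mem_interior_cone_comm h.smul_mem).1 hC)

/-- The ω-limit set is ordered. -/
theorem orderedSet_omegaSet (h : FocusingOrbit Φ C x ψ κ τ r η t₀ N) :
    OrderedSet C (omegaSet Φ x) := by
  intro p hp q hq
  by_contra hpq
  obtain ⟨σ, hσ, hσC⟩ : ∃ σ > 0, ∀ s, 0 ≤ s → s ≤ σ → ψ s q - p ∉ C := by
    have h1 : ∀ᶠ s in nhds (0 : ℝ), ψ s q - p ∉ C := by
      refine (h.closed.isOpen_compl.preimage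
        ((h.continuous_psi hq).sub (continuous_const (y := p)))).mem_nhds (x := 0) ?_
      change ψ 0 q - p ∉ C
      rwa [h.psi_zero hq, sub_mem_cone_comm h.smul_mem]
    obtain ⟨ε, hε, h2⟩ := Metric.eventually_nhds_iff.1 h1
    refine ⟨ε / 2, half_pos hε, fun s hs hsε => h2 ?_⟩
    rw [Real.dist_eq, sub_zero, abs_of_nonneg hs]
    linarith
  obtain ⟨T, hT, hTq⟩ := exists_seq_tendsto_of_mem_omegaSet hq
  set l := Ultrafilter.of (atTop : Filter ℕ)
  have hl : (l : Filter ℕ) ≤ atTop := Ultrafilter.of_le _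
  obtain ⟨a, ha, hal⟩ := h.exists_tendsto_of_mem l (fun n => h.psi_mem (-T n) hp)
  have hxa : ∀ ρ, 0 ≤ ρ → ∀ s, 0 ≤ s → s ≤ σ → Φ.toFun (ρ + s) x - ψ ρ a ∉ interior C := by
    intro ρ hρ s hs hsσ hC
    have h1 := (tendsto_const_nhds (x := Φ.toFun (ρ + s) x)).sub (h.tendsto_psi
      (tendsto_const_nhds (x := ρ)) hal (Eventually.of_forall fun n => h.psi_mem _ hp) ha)
    have h2 := (h.tendsto_shift (hT.mono_left hl) hq (hTq.mono_left hl) s).sub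
      (tendsto_const_nhds (x := p))
    refine hσC s hs hsσ (h.closed.mem_of_tendsto h2 ?_)
    filter_upwards [h1.eventually (isOpen_interior.mem_nhds hC),
      (hT.mono_left hl).eventually_ge_atTop ρ] with n hn hnρ
    have h3 := h.mono.1 (T n - ρ) (by linarith) _ _ (interior_subset hn)
    rw [← Φ.map_add _ _ (by linarith) (by linarith), ← h.psi_eq (by linarith)
      (h.psi_mem _ (h.psi_mem _ hp)), h.psi_psi _ _ hp, h.psi_psi _ _ hp] at h3
    rw [show T n - ρ + (ρ + s) = T n + s by ring, show T n - ρ + (ρ + -T n) = 0 by ring,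
      h.psi_zero hp] at h3
    exact h3
  have hfix := h.psi_eq_self_of_orbit hσ ha hxa hp
  rcases h.eq_or_sub_mem_interior_of_fixed hp hfix hq with rfl | hC
  · exact hpq (by rw [sub_self]; exact h.zero_mem)
  · exact hpq ((sub_mem_cone_comm h.smul_mem).1 (interior_subset hC))

end FocusingOrbit

section OmegaLimit

variable {X : Type*} [NormedAddCommGroup X] [NormedSpace ℝ X]

/-- The ω-limit set of a precompact pseudo-ordered semiorbit is ordered. -/
theorem orderedSet_omegaSet_of_pseudoOrdered [CompleteSpace X] {Φ : Semiflow X}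
    {DΦ : ℝ → X → X →L[ℝ] X} {C : Set X} {k : ℕ} {x : X} (hC : IsKCone C k)
    (hflow : AdmitsFlowExtensions Φ) (hSFM : StronglyFocusingMonotone Φ DΦ C)
    (hpre : IsCompact (closure (posOrbit Φ x))) (hpo : PseudoOrdered Φ C x) :
    OrderedSet C (omegaSet Φ x) := by
  intro p hp q hq
  by_contra hpq
  obtain ⟨ψ, hψ⟩ := hflow x
  have hC0 : (0 : X) ∈ C := by
    obtain ⟨W, hW, -⟩ := hC.2.2.1
    exact hW W.zero_mem
  have hm : MonotoneOrbit Φ C x ψ :=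
    ⟨hC.1, hC.2.1, hC0, zero_notMem_interior_cone hC.2.1 hpq, hSFM.2.2.1, hpre, hψ⟩
  obtain ⟨τ, hτ, t₀, ht₀, hsh⟩ := hm.exists_shift_mem_interior hpo
  obtain ⟨κ, hκ, hκ1, N, hN, r, hr, hgrowth⟩ := hm.exists_growthSet_ball hC hSFM hτ
  obtain ⟨η, hη, hsmall⟩ := hm.exists_small hr
  have h : FocusingOrbit Φ C x ψ κ τ r η t₀ N :=
    { hm with
      ordered := fun z hz s hs => hm.psi_eq_self_or_mem_interior hτ ht₀ hsh hz hs
      t₀_nonneg := ht₀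
      shift := hsh
      κ_pos := hκ
      κ_le := hκ1
      τ_pos := hτ
      N_pos := hN
      r_pos := hr
      η_pos := hη
      growth := hgrowth
      small := hsmall }
  exact hpq (h.orderedSet_omegaSet p hp q hq)

/-- A flow extension on a compact set is conjugate, by any injective continuous map, to a
continuous flow on the image. -/
lemma IsFlowExtensionOn.exists_conjugate {Φ : Semiflow X} {ψ : ℝ → X → X} {S : Set X}
    (hψ : IsFlowExtensionOn Φ ψ S) (hS : IsCompact S) {f : X → X} (hf : ContinuousOn f S)
    (hinj : InjOn f S) :
    ∃ χ : ℝ → X → X,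
      (∀ t : ℝ, ∀ w ∈ f '' S, χ t w ∈ f '' S) ∧
      (∀ w ∈ f '' S, χ 0 w = w) ∧
      (∀ s t : ℝ, ∀ w ∈ f '' S, χ s (χ t w) = χ (s + t) w) ∧
      ContinuousOn (fun q : ℝ × X => χ q.1 q.2) (univ ×ˢ (f '' S)) ∧
      (∀ t, 0 ≤ t → ∀ z ∈ S, f (Φ.toFun t z) = χ t (f z)) := by
  set g := Function.invFunOn f S with hg
  have hgf : ∀ z ∈ S, g (f z) = z := fun z hz => hinj.leftInvOn_invFunOn hz
  have hgS : MapsTo g (f '' S) S := by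
    rintro _ ⟨z, hz, rfl⟩
    rw [hgf z hz]; exact hz
  have hgc : ContinuousOn g (f '' S) := by
    refine continuousOn_iff_isClosed.2 fun F hF => ⟨f '' (S ∩ F), ?_, ?_⟩
    · exact ((hS.inter_right hF).image_of_continuousOn (hf.mono inter_subset_left)).isClosed
    · ext w
      constructor
      · rintro ⟨hw, z, hz, rfl⟩
        rw [mem_preimage, hgf z hz] at hw
        exact ⟨⟨z, ⟨hz, hw⟩, rfl⟩, z, hz, rfl⟩
      · rintro ⟨⟨z, ⟨hz, hzF⟩, rfl⟩, -⟩
        exact ⟨by rwa [mem_preimage, hgf z hz], z, hz, rfl⟩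
  refine ⟨fun t w => f (ψ t (g w)), ?_, ?_, ?_, ?_, ?_⟩
  · exact fun t w hw => mem_image_of_mem f (hψ.2.1 t _ (hgS hw))
  · rintro _ ⟨z, hz, rfl⟩
    dsimp only
    rw [hgf z hz, hψ.1 0 le_rfl z hz, Φ.map_zero]
  · rintro s t _ ⟨z, hz, rfl⟩
    dsimp only
    rw [hgf z hz, hgf _ (hψ.2.1 t z hz), hψ.2.2.1 s t z hz]
  · refine hf.comp (hψ.2.2.2.comp (continuousOn_fst.prodMk (hgc.comp continuousOn_snd
      fun q hq => hq.2)) fun q hq => ⟨mem_univ _, hgS hq.2⟩) fun q hq => hψ.2.1 _ _ (hgS hq.2)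
  · intro t ht z hz
    dsimp only
    rw [hgf z hz, hψ.1 t ht z hz]

end OmegaLimit

/-- **Theorem A, second part.** The projection `Θ` onto a `k`-dimensional subspace
`H ⊆ C` along a complementary closed subspace `Hc` with `Hc \ {0} ⊆ X \ C` is injective
on `ω(x)`; its image is compact and carries a continuous flow conjugating `Φ` on `ω(x)`,
so `ω(x)` is topologically conjugate to a compact invariant set of a flow on a
`k`-dimensional space. -/
theorem omega_embeds_in_Rk
    {X : Type*} [NormedAddCommGroup X] [NormedSpace ℝ X] [CompleteSpace X]
    (Φ : Semiflow X) (DΦ : ℝ → X → X →L[ℝ] X) (C : Set X) (k : ℕ) (hk : 1 ≤ k)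
    (hSA : StandingAssumptions Φ DΦ C k)
    (hSFM : StronglyFocusingMonotone Φ DΦ C)
    (x : X) (hpre : IsCompact (closure (posOrbit Φ x)))
    (hpo : PseudoOrdered Φ C x)
    (H Hc : Submodule ℝ X)
    (hH : (H : Set X) ⊆ C) (hHrank : Module.rank ℝ H = k)
    (hHcc : IsClosed (Hc : Set X)) (hHcrank : Module.rank ℝ (X ⧸ Hc) = k)
    (hHcC : ((Hc : Set X) \ {0}) ⊆ Cᶜ) (hcompl : IsCompl H Hc)
    (Θ : X →L[ℝ] X) (hΘH : ∀ v : X, Θ v ∈ H) (hΘid : ∀ v ∈ H, Θ v = v)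
    (hΘker : ∀ v ∈ Hc, Θ v = 0) :
    Set.InjOn (⇑Θ) (omegaSet Φ x) ∧
    IsCompact (Θ '' omegaSet Φ x) ∧
    ∃ ψ : ℝ → X → X,
      (∀ t : ℝ, ∀ w ∈ Θ '' omegaSet Φ x, ψ t w ∈ Θ '' omegaSet Φ x) ∧
      (∀ w ∈ Θ '' omegaSet Φ x, ψ 0 w = w) ∧
      (∀ s t : ℝ, ∀ w ∈ Θ '' omegaSet Φ x, ψ s (ψ t w) = ψ (s + t) w) ∧
      ContinuousOn (fun q : ℝ × X => ψ q.1 q.2) (Set.univ ×ˢ (Θ '' omegaSet Φ x)) ∧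
      (∀ t, 0 ≤ t → ∀ z ∈ omegaSet Φ x, Θ (Φ.toFun t z) = ψ t (Θ z)) := by
  obtain ⟨hC, -, -, -, hflow⟩ := hSA
  have hord := orderedSet_omegaSet_of_pseudoOrdered hC hflow hSFM hpre hpo
  have hcomp := isCompact_omegaSet hpre
  have hinj : Set.InjOn (⇑Θ) (omegaSet Φ x) := by
    intro z hz w hw hzw
    obtain ⟨a, ha, b, hb, hab⟩ := Submodule.mem_sup.1
      (hcompl.sup_eq_top ▸ Submodule.mem_top : z - w ∈ H ⊔ Hc)
    have h1 : Θ (z - w) = a := by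
      rw [← hab, map_add, hΘid a ha, hΘker b hb, add_zero]
    rw [map_sub, hzw, sub_self] at h1
    rw [← h1, zero_add] at hab
    by_contra hne
    exact hHcC ⟨hb, fun h0 => hne (sub_eq_zero.1 (hab ▸ h0))⟩ (hab ▸ hord z hz w hw)
  obtain ⟨ψ, hψ⟩ := hflow x
  exact ⟨hinj, hcomp.image Θ.continuous, hψ.exists_conjugate hcomp Θ.continuous.continuousOn hinj⟩
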